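/- arXiv:1607.07069 — 2 statements merged into one kernel-verified Lean document; each statement's English description precedes it below -/
import Mathlib

section
/- Fix k ≥ 1 and α₁, α₂, … ≥ 0, and let X = X(n; p₁, p₂, …) be the multiparameter random complex with p_i = n^{−α_i} for every i. If Σ_{i=1}^{k} α_i·C(k,i) < 1, then w.h.p. the reduced homology group H̃_{k−1}(X, ℚ) = 0. If Σ_{i=1}^{k} α_i·C(k,i) ≥ 1 and Σ_{i=1}^{k−1} α_i·C(k−1,i) < 1, then w.h.p. H̃_{k−1}(X, ℚ) ≠ 0. -/
open MeasureTheory Filter Finset Matrix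

noncomputable section

/-- Bernoulli measure on `Bool` with success probability `p` (clamped to `[0,1]`). -/
def bernoulliBool (p : ℝ) : Measure Bool :=
  ENNReal.ofReal (max 0 (min p 1)) • Measure.dirac true +
    ENNReal.ofReal (1 - max 0 (min p 1)) • Measure.dirac false

instance (p : ℝ) : IsFiniteMeasure (bernoulliBool p) := by
  constructor
  simp only [bernoulliBool, Measure.add_apply, Measure.smul_apply, smul_eq_mul,
    measure_univ, mul_one]
  exact ENNReal.add_lt_top.mpr ⟨ENNReal.ofReal_lt_top, ENNReal.ofReal_lt_top⟩

/-- Index type for potential `d`-dimensional faces on vertex set `Fin n`: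
the `(d+1)`-element subsets. -/
abbrev FaceIdx (n d : ℕ) : Type := {s : Finset (Fin n) // s.card = d + 1}

/-- The distribution of the random `d`-complex `Y_d(n,p)`: each potential `d`-face
gets an independent Bernoulli(`p`) coin. (For `d = 1` this is the Erdős–Rényi model
`G(n,p)`.) -/
def YMeasure (n d : ℕ) (p : ℝ) : Measure (FaceIdx n d → Bool) :=
  Measure.pi fun _ => bernoulliBool p

/-- The random `d`-complex: all faces of dimension `≤ d - 1` (i.e. all subsets of
cardinality `≤ d`, including `∅`, so that degree-0 homology below is reduced
homology), together with the chosen `d`-faces. -/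
def Ycomplex (n d : ℕ) (ω : FaceIdx n d → Bool) : Finset (Finset (Fin n)) :=
  Finset.univ.filter fun s => s.card ≤ d ∨ ∃ h : s.card = d + 1, ω ⟨s, h⟩ = true

/-- The Erdős–Rényi random graph associated to a configuration of edge coins. -/
def graphOf (n : ℕ) (ω : FaceIdx n 1 → Bool) : SimpleGraph (Fin n) where
  Adj i j := i ≠ j ∧ ∃ e : FaceIdx n 1, ω e = true ∧ i ∈ e.1 ∧ j ∈ e.1
  symm := ⟨fun i j ⟨hne, e, he, hi, hj⟩ => ⟨hne.symm, e, he, hj, hi⟩⟩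
  loopless := ⟨fun i ⟨hne, _⟩ => hne rfl⟩

instance (n : ℕ) (ω : FaceIdx n 1 → Bool) : DecidableRel (graphOf n ω).Adj :=
  fun i j =>
    inferInstanceAs (Decidable (i ≠ j ∧ ∃ e : FaceIdx n 1, ω e = true ∧ i ∈ e.1 ∧ j ∈ e.1))

/-- The clique complex of the graph determined by the edge coins `ω`:
faces are vertex sets of complete subgraphs (including `∅` and singletons). -/
def cliqueComplex (n : ℕ) (ω : FaceIdx n 1 → Bool) : Finset (Finset (Fin n)) :=
  Finset.univ.filter fun s => ∀ i ∈ s, ∀ j ∈ s, i ≠ j → (graphOf n ω).Adj i j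

/-- The group of simplicial `G`-chains of a complex `K`, in cardinality `c`
(i.e. dimension `c - 1`): functions on the faces of `K` of cardinality `c`. -/
abbrev Chains {V : Type} [Fintype V] [DecidableEq V]
    (K : Finset (Finset V)) (c : ℕ) (G : Type) : Type :=
  {s : Finset V // s ∈ K ∧ s.card = c} → G

/-- The simplicial boundary map, from chains of cardinality `c+1` to chains of
cardinality `c`, with the usual alternating signs coming from the linear order
on the vertices. -/
def chainBoundary {V : Type} [Fintype V] [DecidableEq V] [LinearOrder V]
    (K : Finset (Finset V)) (c : ℕ) {G : Type} [AddCommGroup G]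
    (f : Chains K (c + 1) G) : Chains K c G :=
  fun τ => ∑ v : V,
    if h : v ∉ τ.1 ∧ insert v τ.1 ∈ K then
      ((-1 : ℤ) ^ (τ.1.filter (fun u => u < v)).card) •
        f ⟨insert v τ.1, h.2, by rw [Finset.card_insert_of_notMem h.1, τ.2.2]⟩
    else 0

/-- Vanishing of the simplicial homology of `K` with coefficients in `G` in
degree `i` (faces of cardinality `i+1`): every cycle is a boundary.
If `∅ ∈ K` this is reduced homology (the boundary map to cardinality-0 chains
is the augmentation); in degrees `i ≥ 1` reduced and unreduced homology agree. -/
def HomologyZero {V : Type} [Fintype V] [DecidableEq V] [LinearOrder V]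
    (K : Finset (Finset V)) (i : ℕ) (G : Type) [AddCommGroup G] : Prop :=
  ∀ f : Chains K (i + 1) G, chainBoundary K i f = 0 →
    ∃ g : Chains K (i + 2) G, chainBoundary K (i + 1) g = f

/-- Vanishing of top-dimensional homology `H_d(K,G)`, i.e. the kernel of the
`d`-th boundary map is zero. -/
def TopHomologyZero {V : Type} [Fintype V] [DecidableEq V] [LinearOrder V]
    (K : Finset (Finset V)) (d : ℕ) (G : Type) [AddCommGroup G] : Prop :=
  ∀ f : Chains K (d + 1) G, chainBoundary K d f = 0 → f = 0

/-- The boundary map on real coefficients, as a linear map. -/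
def chainBoundaryLin {V : Type} [Fintype V] [DecidableEq V] [LinearOrder V]
    (K : Finset (Finset V)) (c : ℕ) : Chains K (c + 1) ℝ →ₗ[ℝ] Chains K c ℝ where
  toFun := chainBoundary K c
  map_add' f g := by
    funext τ
    simp only [chainBoundary, Pi.add_apply]
    rw [← Finset.sum_add_distrib]
    refine Finset.sum_congr rfl fun v _ => ?_
    split
    · simp [smul_add]
    · simp
  map_smul' r f := by
    funext τ
    simp only [chainBoundary, Pi.smul_apply, RingHom.id_apply]
    rw [Finset.smul_sum]
    refine Finset.sum_congr rfl fun v _ => ?_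
    split
    · exact smul_comm _ _ _
    · simp

/-- The `k`-th Betti number of `K`: the dimension of the `k`-th real simplicial
homology, i.e. of (kernel of `∂_k`) / (image of `∂_{k+1}`). -/
def bettiNumber {V : Type} [Fintype V] [DecidableEq V] [LinearOrder V]
    (K : Finset (Finset V)) (k : ℕ) : ℕ :=
  Module.finrank ℝ
    (↥(LinearMap.ker (chainBoundaryLin K k)) ⧸
      (LinearMap.range (chainBoundaryLin K (k + 1))).comap
        (LinearMap.ker (chainBoundaryLin K k)).subtype)

/-- The link of a face `σ` in the complex `K`. -/
def linkSet {V : Type} [Fintype V] [DecidableEq V]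
    (K : Finset (Finset V)) (σ : Finset V) : Finset (Finset V) :=
  Finset.univ.filter fun τ => τ ∩ σ = ∅ ∧ τ ∪ σ ∈ K

/-- The graph underlying the link of a face `σ`: its vertices are the vertices
of the link, joined when they span an edge of the link. -/
def linkGraph {V : Type} [Fintype V] [DecidableEq V]
    (K : Finset (Finset V)) (σ : Finset V) :
    SimpleGraph {v : V // {v} ∈ linkSet K σ} where
  Adj a b := a ≠ b ∧ ({a.1, b.1} : Finset V) ∈ linkSet K σ
  symm := ⟨fun a b ⟨hab, h⟩ => ⟨hab.symm, by rwa [Finset.pair_comm]⟩⟩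
  loopless := ⟨fun a ⟨hab, _⟩ => hab rfl⟩

instance {V : Type} [Fintype V] [DecidableEq V] (K : Finset (Finset V)) (σ : Finset V) :
    DecidableRel (linkGraph K σ).Adj :=
  fun a b => inferInstanceAs (Decidable (a ≠ b ∧ ({a.1, b.1} : Finset V) ∈ linkSet K σ))

/-- The normalized Laplacian `I - D^{-1/2} A D^{-1/2}` of a finite graph. -/
def normalizedLaplacian {W : Type} [Fintype W] [DecidableEq W]
    (H : SimpleGraph W) [DecidableRel H.Adj] : Matrix W W ℝ :=
  Matrix.of fun a b =>
    (if a = b then (1 : ℝ) else 0) -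
      (if H.Adj a b then 1 / Real.sqrt ((H.degree a : ℝ) * (H.degree b : ℝ)) else 0)

/-- An elementary `d`-collapse step: remove a free `(d-1)`-face `σ` together with
the unique `d`-face `τ` containing it. -/
def CollapseStep {V : Type} [DecidableEq V] (d : ℕ) (K K' : Finset (Finset V)) : Prop :=
  ∃ σ τ : Finset V, σ ∈ K ∧ τ ∈ K ∧ τ.card = d + 1 ∧ σ ⊆ τ ∧ σ.card = d ∧
    (∀ ρ ∈ K, σ ⊆ ρ → ρ.card = d + 1 → ρ = τ) ∧ K' = K \ {σ, τ}

/-- `K` is `d`-collapsible if some finite sequence of elementary collapses reduces it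
to a complex of dimension at most `d-1`. -/
def IsDCollapsible {V : Type} [DecidableEq V] (d : ℕ) (K : Finset (Finset V)) : Prop :=
  ∃ K' : Finset (Finset V),
    Relation.ReflTransGen (CollapseStep d) K K' ∧ ∀ s ∈ K', s.card ≤ d

/-- The geometric realization of a complex on vertex set `Fin n`, inside `ℝ^n`:
the union over the faces of the convex hulls of the corresponding standard
basis vectors. -/
def geomReal (n : ℕ) (K : Finset (Finset (Fin n))) : Set (Fin n → ℝ) :=
  ⋃ σ ∈ K, convexHull ℝ ((fun i => (Pi.single i 1 : Fin n → ℝ)) '' ↑σ)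

/-- The boundary of the simplex on the vertex set `τ`, as a chain of cardinality
`c` (to be used with `τ.card = c + 1`): the alternating sum of the `c`-element
subsets of `τ`. -/
def simplexBoundaryChain {V : Type} [Fintype V] [DecidableEq V] [LinearOrder V]
    (K : Finset (Finset V)) (c : ℕ) (τ : Finset V) : Chains K c ℝ :=
  fun σ => ∑ v ∈ τ,
    if σ.1 = τ.erase v then ((-1 : ℝ) ^ (τ.filter (fun u => u < v)).card) else 0

/-- Index type for the multiparameter model: all potential faces of dimension `≥ 1`. -/
abbrev MultiIdx (n : ℕ) : Type := {s : Finset (Fin n) // 2 ≤ s.card}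

/-- The distribution of the multiparameter random complex `X(n; p₁, p₂, …)`:
a potential face of cardinality `i+1` gets an independent Bernoulli(`p i`) coin. -/
def multiMeasure (n : ℕ) (p : ℕ → ℝ) : Measure (MultiIdx n → Bool) :=
  Measure.pi fun t => bernoulliBool (p (t.1.card - 1))

/-- The multiparameter random complex: a set `s` is a face iff every subset of `s`
of dimension `≥ 1` has its coin turned on (this is exactly the
inductive-by-dimension construction: a face is present iff its coin is on and all
of its boundary faces are present). -/
def multiComplex (n : ℕ) (ω : MultiIdx n → Bool) : Finset (Finset (Fin n)) :=
  Finset.univ.filter fun s => ∀ t : MultiIdx n, t.1 ⊆ s → ω t = true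

/-- The Vietoris–Rips complex of the points `pts` at scale `r`. -/
def VRcomplex (n d : ℕ) (pts : Fin n → EuclideanSpace ℝ (Fin d)) (r : ℝ) :
    Finset (Finset (Fin n)) :=
  Finset.univ.filter fun s => ∀ i ∈ s, ∀ j ∈ s, dist (pts i) (pts j) ≤ r

end

section Det
set_option linter.unusedSectionVars false
variable {V : Type} [Fintype V] [DecidableEq V] [LinearOrder V]

def sg (τ : Finset V) (v : V) : ℤ := (-1 : ℤ) ^ (τ.filter (fun u => u < v)).card

lemma sg_sq (τ : Finset V) (v : V) : sg τ v * sg τ v = 1 := by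
  unfold sg
  rw [← mul_pow]; simp

lemma sg_insert (τ : Finset V) (u v : V) (h : v ∉ τ) :
    sg (insert v τ) u = (if v < u then -1 else 1) * sg τ u := by
  unfold sg
  rw [Finset.filter_insert]
  split_ifs with hlt
  · rw [Finset.card_insert_of_notMem (by simp [h]), pow_succ]; ring
  · simp

lemma sg_cross (τ : Finset V) (u v : V) (hu : u ∉ τ) (hv : v ∉ τ) (huv : u ≠ v) :
    sg (insert v τ) u * sg (insert u τ) v = - (sg τ u * sg τ v) := by
  rw [sg_insert τ u v hv, sg_insert τ v u hu]
  rcases lt_or_gt_of_ne huv with h | h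
  · rw [if_neg (not_lt_of_gt h), if_pos h]; ring
  · rw [if_neg (not_lt_of_gt h), if_pos h]; ring

lemma sg_anti (τ : Finset V) (u v : V) (hu : u ∉ τ) (hv : v ∉ τ) (huv : u ≠ v) :
    sg τ v * sg (insert v τ) u = - (sg τ u * sg (insert u τ) v) := by
  rw [sg_insert τ u v hv, sg_insert τ v u hu]
  rcases lt_or_gt_of_ne huv with h | h
  · rw [if_neg (not_lt_of_gt h), if_pos h]; ring
  · rw [if_neg (not_lt_of_gt h), if_pos h]; ring

def extC {K : Finset (Finset V)} {c : ℕ} {G : Type} [AddCommGroup G] (f : Chains K c G)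
    (s : Finset V) : G := if h : s ∈ K ∧ s.card = c then f ⟨s, h⟩ else 0

lemma extC_self {K : Finset (Finset V)} {c : ℕ} {G : Type} [AddCommGroup G] (f : Chains K c G)
    (s : {s : Finset V // s ∈ K ∧ s.card = c}) : extC f s.1 = f s := by
  unfold extC; rw [dif_pos s.2]

lemma boundary_eq {K : Finset (Finset V)} {c : ℕ} {G : Type} [AddCommGroup G]
    (f : Chains K (c + 1) G) (τ) :
    chainBoundary K c f τ = ∑ v : V, if v ∉ τ.1 then sg τ.1 v • extC f (insert v τ.1) else 0 := by
  unfold chainBoundary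
  refine Finset.sum_congr rfl fun v _ => ?_
  by_cases hv : v ∉ τ.1
  · by_cases hK : insert v τ.1 ∈ K
    · rw [dif_pos ⟨hv, hK⟩, if_pos hv]
      unfold extC sg
      rw [dif_pos ⟨hK, by rw [Finset.card_insert_of_notMem hv, τ.2.2]⟩]
    · rw [dif_neg (by tauto), if_pos hv]
      unfold extC
      rw [dif_neg (by tauto)]; simp
  · rw [dif_neg (by tauto), if_neg hv]

lemma boundary_boundary {K : Finset (Finset V)} (hK : ∀ s ∈ K, ∀ t, t ⊆ s → t ∈ K) {c : ℕ}
    (g : Chains K (c + 2) ℚ) : chainBoundary K c (chainBoundary K (c + 1) g) = 0 := by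
  funext τ
  have key : ∀ s : Finset V, s.card = c + 1 → extC (chainBoundary K (c + 1) g) s =
      ∑ v : V, if v ∉ s then sg s v • extC g (insert v s) else 0 := by
    intro s hs
    by_cases h : s ∈ K
    · rw [extC, dif_pos ⟨h, hs⟩, boundary_eq]
    · rw [extC, dif_neg (by tauto)]
      symm
      refine Finset.sum_eq_zero fun v _ => ?_
      rw [extC, dif_neg]
      · simp
      · rintro ⟨h1, _⟩
        exact h (hK _ h1 _ (Finset.subset_insert _ _))
  rw [boundary_eq]
  set S := ∑ v : V, ∑ u : V, if v ∉ τ.1 ∧ u ∉ τ.1 ∧ u ≠ v then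
    (sg τ.1 v * sg (insert v τ.1) u) • extC g (insert u (insert v τ.1)) else 0 with hS
  have h1 : (∑ v : V, if v ∉ τ.1 then sg τ.1 v • extC (chainBoundary K (c + 1) g) (insert v τ.1)
      else 0) = S := by
    refine Finset.sum_congr rfl fun v _ => ?_
    by_cases hv : v ∉ τ.1
    · rw [if_pos hv, key _ (by rw [Finset.card_insert_of_notMem hv, τ.2.2]), Finset.smul_sum]
      refine Finset.sum_congr rfl fun u _ => ?_
      by_cases hu : u ∉ insert v τ.1
      · rw [if_pos hu, if_pos, smul_smul]
        simp only [Finset.mem_insert, not_or] at hu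
        tauto
      · rw [if_neg hu, if_neg, smul_zero]
        simp only [Finset.mem_insert, not_or] at hu
        tauto
    · rw [if_neg hv]
      symm
      refine Finset.sum_eq_zero fun u _ => ?_
      rw [if_neg (by tauto)]
  have h2 : S = -S := by
    conv_lhs => rw [hS, Finset.sum_comm]
    rw [hS, ← Finset.sum_neg_distrib]
    refine Finset.sum_congr rfl fun v _ => ?_
    rw [← Finset.sum_neg_distrib]
    refine Finset.sum_congr rfl fun u _ => ?_
    by_cases h : v ∉ τ.1 ∧ u ∉ τ.1 ∧ u ≠ v
    · rw [if_pos h, if_pos ⟨h.2.1, h.1, h.2.2.symm⟩, sg_anti τ.1 v u h.1 h.2.1 h.2.2.symm,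
        Finset.insert_comm, neg_smul]
    · rw [if_neg h, if_neg (by tauto), neg_zero]
  rw [h1]
  show S = 0
  linarith

/-- incidence matrix -/
def incM (K : Finset (Finset V)) (c : ℕ) :
    Matrix {s : Finset V // s ∈ K ∧ s.card = c} {s : Finset V // s ∈ K ∧ s.card = c + 1} ℚ :=
  Matrix.of fun s η => ∑ v : V, if v ∉ s.1 ∧ insert v s.1 = η.1 then (sg s.1 v : ℚ) else 0

lemma incM_mulVec (K : Finset (Finset V)) (c : ℕ) (g : Chains K (c + 1) ℚ) :
    (incM K c) *ᵥ g = chainBoundary K c g := by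
  funext s
  rw [boundary_eq]
  simp only [Matrix.mulVec, dotProduct, incM, Matrix.of_apply]
  simp_rw [Finset.sum_mul]
  rw [Finset.sum_comm]
  refine Finset.sum_congr rfl fun v _ => ?_
  by_cases hv : v ∉ s.1
  · rw [if_pos hv]
    by_cases hm : insert v s.1 ∈ K
    · have hm' : insert v s.1 ∈ K ∧ (insert v s.1).card = c + 1 :=
        ⟨hm, by rw [Finset.card_insert_of_notMem hv, s.2.2]⟩
      rw [Finset.sum_eq_single ⟨insert v s.1, hm'⟩]
      · rw [if_pos ⟨hv, rfl⟩, extC, dif_pos hm', zsmul_eq_mul]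
      · intro b _ hb
        rw [if_neg, zero_mul]
        rintro ⟨_, h⟩
        exact hb (Subtype.ext h.symm)
      · simp
    · rw [extC, dif_neg (by tauto), smul_zero]
      refine Finset.sum_eq_zero fun η _ => ?_
      rw [if_neg, zero_mul]
      rintro ⟨_, h⟩
      exact hm (h ▸ η.2.1)
  · rw [if_neg hv]
    refine Finset.sum_eq_zero fun η _ => ?_
    rw [if_neg (by tauto), zero_mul]

lemma incM_vecMul (K : Finset (Finset V)) (c : ℕ) (h : Chains K c ℚ) (η) :
    ((incM K c)ᵀ *ᵥ h) η = ∑ w ∈ η.1, (sg (η.1.erase w) w : ℚ) * extC h (η.1.erase w) := by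
  simp only [Matrix.mulVec, dotProduct, incM, Matrix.of_apply, Matrix.transpose_apply]
  simp_rw [Finset.sum_mul]
  rw [Finset.sum_comm, ← Finset.sum_subset (Finset.subset_univ η.1)]
  · refine Finset.sum_congr rfl fun v hv => ?_
    by_cases hm : η.1.erase v ∈ K
    · have hm' : η.1.erase v ∈ K ∧ (η.1.erase v).card = c :=
        ⟨hm, by rw [Finset.card_erase_of_mem hv, η.2.2]; rfl⟩
      rw [Finset.sum_eq_single ⟨η.1.erase v, hm'⟩]
      · rw [if_pos ⟨by simp, by simp [Finset.insert_erase hv]⟩, extC, dif_pos hm']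
      · intro b _ hb
        rw [if_neg, zero_mul]
        rintro ⟨h1, h⟩
        refine hb (Subtype.ext ?_)
        show b.1 = η.1.erase v
        rw [← h, Finset.erase_insert h1]
      · simp
    · rw [extC, dif_neg (by tauto), mul_zero]
      refine Finset.sum_eq_zero fun s _ => ?_
      rw [if_neg, zero_mul]
      rintro ⟨h1, h⟩
      apply hm
      rw [← h, Finset.erase_insert h1]
      exact s.2.1
  · intro v _ hv
    refine Finset.sum_eq_zero fun s _ => ?_
    rw [if_neg, zero_mul]
    rintro ⟨h1, h⟩
    exact hv (h ▸ Finset.mem_insert_self _ _)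

lemma normal_eq {m n : Type} [Fintype m] [Fintype n] [DecidableEq m] [DecidableEq n]
    (A : Matrix m n ℚ) (f : m → ℚ) : ∃ g : n → ℚ, Aᵀ *ᵥ (f - A *ᵥ g) = 0 := by
  have h1 : LinearMap.range (Aᵀ * A).mulVecLin ≤ LinearMap.range (Aᵀ).mulVecLin := by
    rw [Matrix.mulVecLin_mul]
    exact LinearMap.range_comp_le_range _ _
  have h2 : LinearMap.range (Aᵀ * A).mulVecLin = LinearMap.range (Aᵀ).mulVecLin := by
    apply Submodule.eq_of_le_of_finrank_eq h1
    have e1 := Matrix.rank_transpose_mul_self A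
    have e2 := Matrix.rank_transpose A
    unfold Matrix.rank at e1 e2
    rw [e1, e2]
  have h3 : (Aᵀ).mulVecLin f ∈ LinearMap.range (Aᵀ * A).mulVecLin := by
    rw [h2]; exact ⟨f, rfl⟩
  obtain ⟨g, hg⟩ := h3
  refine ⟨g, ?_⟩
  simp only [Matrix.mulVecLin_apply] at hg
  rw [Matrix.mulVec_sub, Matrix.mulVec_mulVec, hg, sub_self]

lemma sum_reindex (H : Finset V → V → ℝ) :
    (∑ η : Finset V, ∑ w : V, if w ∈ η then H η w else 0) =
      ∑ σ : Finset V, ∑ w : V, if w ∉ σ then H (insert w σ) w else 0 := by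
  rw [Finset.sum_comm]
  conv_rhs => rw [Finset.sum_comm]
  refine Finset.sum_congr rfl fun w _ => ?_
  rw [← Finset.sum_filter, ← Finset.sum_filter]
  refine Finset.sum_bij' (fun η _ => η.erase w) (fun σ _ => insert w σ) ?_ ?_ ?_ ?_ ?_
  · intro a _; simp
  · intro a _; simp
  · intro a ha; simp at ha; exact Finset.insert_erase ha
  · intro a ha; simp at ha; exact Finset.erase_insert ha
  · intro a ha; simp at ha; rw [Finset.insert_erase ha]

lemma garland (K : Finset (Finset V)) (c : ℕ) (lam dmin : ℝ) (hlam : lam * (c + 1) < dmin)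
    (hdeg : ∀ σ ∈ K, σ.card = c + 1 →
      dmin ≤ ((univ.filter fun v => v ∉ σ ∧ insert v σ ∈ K).card : ℝ))
    (hspec : ∀ τ : Finset V, τ.card = c → ∀ φ : V → ℝ,
      (∀ u, φ u ≠ 0 → u ∉ τ ∧ insert u τ ∈ K) → ∑ u, φ u = 0 →
      (∑ v, ∑ u, if u ≠ v ∧ insert u (insert v τ) ∈ K then φ u * φ v else 0) ≤ lam * ∑ u, φ u ^ 2)
    (F : Finset V → ℝ) (hF : ∀ s, F s ≠ 0 → s ∈ K ∧ s.card = c + 1)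
    (h1 : ∀ τ : Finset V, τ.card = c → (∑ v, if v ∉ τ then (sg τ v : ℝ) * F (insert v τ) else 0) = 0)
    (h2 : ∀ η ∈ K, η.card = c + 2 → ∑ w ∈ η, (sg (η.erase w) w : ℝ) * F (η.erase w) = 0) :
    ∀ s, F s = 0 := by
  classical
  let oneK : Finset V → ℝ := fun η => if η ∈ K ∧ η.card = c + 2 then 1 else 0
  let a : Finset V → V → ℝ := fun η w => (sg (η.erase w) w : ℝ) * F (η.erase w)
  have sgR : ∀ (τ : Finset V) v, (sg τ v : ℝ) * sg τ v = 1 := by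
    intro τ v; exact_mod_cast sg_sq τ v
  -- LHS
  have L1 : (∑ η : Finset V, ∑ w : V, if w ∈ η then oneK η * (F (η.erase w))^2 else 0) =
      ∑ σ : Finset V, ((univ.filter fun v => v ∉ σ ∧ insert v σ ∈ K).card : ℝ) * F σ ^ 2 := by
    rw [sum_reindex (fun η w => oneK η * (F (η.erase w))^2)]
    refine Finset.sum_congr rfl fun σ _ => ?_
    by_cases h0 : F σ = 0
    · rw [h0]
      simp only [ne_eq, OfNat.ofNat_ne_zero, not_false_eq_true, zero_pow, mul_zero]
      refine Finset.sum_eq_zero fun w _ => ?_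
      split_ifs with hw
      · rfl
      · rw [Finset.erase_insert hw, h0]; simp
    · obtain ⟨hσ, hc⟩ := hF σ h0
      rw [Finset.card_filter, Nat.cast_sum, Finset.sum_mul]
      refine Finset.sum_congr rfl fun w _ => ?_
      by_cases hw : w ∉ σ
      · rw [if_pos hw, Finset.erase_insert hw]
        simp only [oneK]
        by_cases hi : insert w σ ∈ K
        · rw [if_pos ⟨hi, by rw [Finset.card_insert_of_notMem hw, hc]⟩, if_pos ⟨hw, hi⟩]; simp
        · rw [if_neg (by tauto), if_neg (by tauto)]; simp
      · rw [if_neg hw, if_neg (by tauto)]; simp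
  have L2 : dmin * ∑ σ : Finset V, F σ ^ 2 ≤
      ∑ σ : Finset V, ((univ.filter fun v => v ∉ σ ∧ insert v σ ∈ K).card : ℝ) * F σ ^ 2 := by
    rw [Finset.mul_sum]
    refine Finset.sum_le_sum fun σ _ => ?_
    by_cases h0 : F σ = 0
    · rw [h0]; simp
    · obtain ⟨hσ, hc⟩ := hF σ h0
      exact mul_le_mul_of_nonneg_right (hdeg σ hσ hc) (sq_nonneg _)
  -- identity
  have I1 : (∑ η : Finset V, ∑ w : V, if w ∈ η then oneK η * (F (η.erase w))^2 else 0) =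
      ∑ η : Finset V, ∑ w : V, if w ∈ η then
        (∑ w' : V, if w' ∈ η.erase w then - (oneK η * (a η w * a η w')) else 0) else 0 := by
    refine Finset.sum_congr rfl fun η _ => ?_
    by_cases hη : η ∈ K ∧ η.card = c + 2
    · have hs := h2 η hη.1 hη.2
      refine Finset.sum_congr rfl fun w _ => ?_
      by_cases hw : w ∈ η
      · rw [if_pos hw, if_pos hw]
        simp only [oneK, if_pos hη, one_mul]
        rw [← Finset.sum_filter, Finset.filter_mem_eq_inter, Finset.univ_inter,
          Finset.sum_neg_distrib, ← Finset.mul_sum]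
        have : ∑ i ∈ η.erase w, a η i = - a η w := by
          rw [← Finset.add_sum_erase η _ hw] at hs
          simp only [a]; linarith
        rw [this]
        simp only [a]
        linear_combination (-(F (η.erase w))^2) * sgR (η.erase w) w
      · rw [if_neg hw, if_neg hw]
    · simp only [oneK, if_neg hη, zero_mul, neg_zero, ite_self, Finset.sum_const_zero]
  let φ : Finset V → V → ℝ := fun τ v => if v ∉ τ then (sg τ v : ℝ) * F (insert v τ) else 0
  have I2 : (∑ η : Finset V, ∑ w : V, if w ∈ η then
        (∑ w' : V, if w' ∈ η.erase w then - (oneK η * (a η w * a η w')) else 0) else 0) =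
      ∑ τ : Finset V, ∑ v : V, ∑ u : V, if u ≠ v then oneK (insert u (insert v τ)) *
        (φ τ u * φ τ v) else 0 := by
    rw [sum_reindex (fun η w => ∑ w' : V, if w' ∈ η.erase w then - (oneK η * (a η w * a η w')) else 0)]
    have e : ∀ σ : Finset V, (∑ w : V, if w ∉ σ then (∑ w' : V, if w' ∈ (insert w σ).erase w then
        - (oneK (insert w σ) * (a (insert w σ) w * a (insert w σ) w')) else 0) else 0) =
        ∑ w' : V, if w' ∈ σ then (∑ w : V, if w ∉ σ then
          - (oneK (insert w σ) * (a (insert w σ) w * a (insert w σ) w')) else 0) else 0 := by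
      intro σ
      have : ∀ w' : V, (if w' ∈ σ then (∑ w : V, if w ∉ σ then
          - (oneK (insert w σ) * (a (insert w σ) w * a (insert w σ) w')) else 0) else 0) =
          ∑ w : V, if w' ∈ σ then (if w ∉ σ then
          - (oneK (insert w σ) * (a (insert w σ) w * a (insert w σ) w')) else 0) else 0 := by
        intro w'
        split_ifs <;> simp
      simp_rw [this]
      rw [Finset.sum_comm]
      refine Finset.sum_congr rfl fun w _ => ?_
      by_cases hw : w ∉ σ
      · simp only [if_pos hw, Finset.erase_insert hw]
      · simp only [if_neg hw, ite_self, Finset.sum_const_zero]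
    simp_rw [e]
    rw [sum_reindex (fun σ w' => ∑ w : V, if w ∉ σ then
          - (oneK (insert w σ) * (a (insert w σ) w * a (insert w σ) w')) else 0)]
    refine Finset.sum_congr rfl fun τ _ => ?_
    refine Finset.sum_congr rfl fun v _ => ?_
    by_cases hv : v ∉ τ
    · rw [if_pos hv]
      refine Finset.sum_congr rfl fun u _ => ?_
      by_cases hu : u ∉ τ
      · by_cases huv : u ≠ v
        · rw [if_pos (by simp [huv, hu]), if_pos huv]
          simp only [φ, if_pos hu, if_pos hv, a]
          rw [Finset.erase_insert (by simp [huv, hu]), Finset.insert_comm u v τ,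
            Finset.erase_insert (by simp [huv.symm, hv])]
          have := sg_cross τ u v hu hv huv
          have : (sg (insert v τ) u : ℝ) * sg (insert u τ) v = - (sg τ u * sg τ v) := by
            exact_mod_cast this
          linear_combination (-oneK (insert v (insert u τ)) * F (insert v τ) * F (insert u τ)) * this
        · rw [if_neg (by simp; tauto), if_neg huv]
      · rw [if_neg (by simp; tauto)]
        simp only [φ, if_neg hu]; simp
    · rw [if_neg hv]
      symm
      refine Finset.sum_eq_zero fun u _ => ?_
      simp only [φ, if_neg hv]; simp
  have I3 : (∑ τ : Finset V, ∑ v : V, ∑ u : V, if u ≠ v then oneK (insert u (insert v τ)) *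
        (φ τ u * φ τ v) else 0) ≤ ∑ τ : Finset V, lam * ∑ u, φ τ u ^ 2 := by
    refine Finset.sum_le_sum fun τ _ => ?_
    by_cases hτ : τ.card = c
    · refine le_trans (le_of_eq ?_) (hspec τ hτ (φ τ) ?_ (h1 τ hτ))
      · refine Finset.sum_congr rfl fun v _ => Finset.sum_congr rfl fun u _ => ?_
        by_cases hv : v ∉ τ
        · by_cases hu : u ∉ τ
          · by_cases huv : u ≠ v
            · rw [if_pos huv]
              simp only [oneK]
              by_cases hi : insert u (insert v τ) ∈ K
              · rw [if_pos ⟨hi, by rw [Finset.card_insert_of_notMem (by simp [huv, hu]),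
                  Finset.card_insert_of_notMem hv, hτ]⟩, if_pos ⟨huv, hi⟩, one_mul]
              · rw [if_neg (by tauto), if_neg (by tauto), zero_mul]
            · rw [if_neg huv, if_neg (by tauto)]
          · simp only [φ, if_neg hu]; simp
        · simp only [φ, if_neg hv]; simp
      · intro u hu
        simp only [φ] at hu
        split_ifs at hu with h
        · exact absurd rfl hu
        · exact ⟨h, (hF _ (right_ne_zero_of_mul hu)).1⟩
    · have : ∀ u, φ τ u = 0 := by
        intro u
        by_contra hu
        simp only [φ] at hu
        split_ifs at hu with h
        · exact hu rfl
        · have := (hF _ (right_ne_zero_of_mul hu)).2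
          rw [Finset.card_insert_of_notMem h] at this
          omega
      simp [this]
  have I4 : ∑ τ : Finset V, ∑ u, φ τ u ^ 2 = (c + 1) * ∑ σ : Finset V, F σ ^ 2 := by
    have e : ∀ τ : Finset V, ∀ u : V, φ τ u ^ 2 = if u ∉ τ then F (insert u τ) ^ 2 else 0 := by
      intro τ u
      simp only [φ]
      split_ifs with h
      · simp
      · linear_combination (F (insert u τ) ^ 2) * sgR τ u
    simp_rw [e]
    rw [← sum_reindex (fun σ _ => F σ ^ 2), Finset.mul_sum]
    refine Finset.sum_congr rfl fun σ _ => ?_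
    rw [← Finset.sum_filter, Finset.filter_mem_eq_inter, Finset.univ_inter, Finset.sum_const]
    by_cases h0 : F σ = 0
    · rw [h0]; simp
    · rw [(hF σ h0).2]; simp
  rw [← Finset.mul_sum, I4, ← I2, ← I1, L1] at I3
  have hS : ∑ σ : Finset V, F σ ^ 2 ≤ 0 := by
    by_contra hcon
    push Not at hcon
    nlinarith
  have hS0 : ∑ σ : Finset V, F σ ^ 2 = 0 := le_antisymm hS (Finset.sum_nonneg fun _ _ => sq_nonneg _)
  intro s
  have := (Finset.sum_eq_zero_iff_of_nonneg (fun _ _ => sq_nonneg _)).1 hS0 s (Finset.mem_univ _)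
  exact pow_eq_zero_iff (two_ne_zero) |>.1 this

theorem homology_zero_of (K : Finset (Finset V)) (hK : ∀ s ∈ K, ∀ t, t ⊆ s → t ∈ K)
    (c : ℕ) (lam dmin : ℝ) (hlam : lam * (c + 1) < dmin)
    (hdeg : ∀ σ ∈ K, σ.card = c + 1 →
      dmin ≤ ((univ.filter fun v => v ∉ σ ∧ insert v σ ∈ K).card : ℝ))
    (hspec : ∀ τ : Finset V, τ.card = c → ∀ φ : V → ℝ,
      (∀ u, φ u ≠ 0 → u ∉ τ ∧ insert u τ ∈ K) → ∑ u, φ u = 0 →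
      (∑ v, ∑ u, if u ≠ v ∧ insert u (insert v τ) ∈ K then φ u * φ v else 0) ≤ lam * ∑ u, φ u ^ 2) :
    HomologyZero K c ℚ := by
  intro f hf
  obtain ⟨g, hg⟩ := normal_eq (incM K (c + 1)) f
  refine ⟨g, ?_⟩
  set h : Chains K (c + 1) ℚ := f - (incM K (c + 1)) *ᵥ g with hh
  have hb : chainBoundary K c h = 0 := by
    rw [← incM_mulVec, hh, Matrix.mulVec_sub, incM_mulVec, incM_mulVec, incM_mulVec, hf,
      boundary_boundary hK, sub_zero]
  have h0 : ∀ s, ((extC h s : ℚ) : ℝ) = 0 := by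
    refine garland K c lam dmin hlam hdeg hspec (fun s => ((extC h s : ℚ) : ℝ)) ?_ ?_ ?_
    · intro s hs
      by_contra hcon
      apply hs
      rw [extC, dif_neg hcon]; simp
    · intro τ hτ
      by_cases hτK : τ ∈ K
      · have := congrFun hb ⟨τ, hτK, hτ⟩
        rw [boundary_eq] at this
        have h3 := congrArg (fun x : ℚ => (x : ℝ)) this
        simp only [Pi.zero_apply, Rat.cast_zero, Rat.cast_sum] at h3
        refine Eq.trans ?_ h3
        refine Finset.sum_congr rfl fun v _ => ?_
        split_ifs <;> simp
      · refine Finset.sum_eq_zero fun v _ => ?_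
        rw [extC, dif_neg]
        · simp
        · rintro ⟨h1, _⟩
          exact hτK (hK _ h1 _ (Finset.subset_insert _ _))
    · intro η hη hc
      have := congrFun hg ⟨η, hη, hc⟩
      rw [incM_vecMul] at this
      have h3 := congrArg (fun x : ℚ => (x : ℝ)) this
      simp only [Pi.zero_apply, Rat.cast_zero, Rat.cast_sum] at h3
      refine Eq.trans ?_ h3
      refine Finset.sum_congr rfl fun v _ => ?_
      push_cast; rfl
  have h1 : h = 0 := by
    funext s
    have := h0 s.1
    rw [extC_self] at this
    exact_mod_cast this
  rw [← incM_mulVec]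
  have := sub_eq_zero.1 (hh.symm.trans h1)
  exact this.symm

theorem morse (K : Finset (Finset V)) (c : ℕ) (h : HomologyZero K c ℚ) :
    (K.filter fun s => s.card = c + 1).card ≤
      (K.filter fun s => s.card = c).card + (K.filter fun s => s.card = c + 2).card := by
  have hc : ∀ c, (K.filter fun s => s.card = c).card =
      Module.finrank ℚ (Chains K c ℚ) := by
    intro c
    rw [Module.finrank_fintype_fun_eq_card, Fintype.card_subtype]
    congr 1
    ext s; simp
  rw [hc, hc, hc]
  have e1 := (incM K c).mulVecLin.finrank_range_add_finrank_ker
  have e2 : LinearMap.ker (incM K c).mulVecLin ≤ LinearMap.range (incM K (c + 1)).mulVecLin := by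
    intro f hf
    rw [LinearMap.mem_ker, Matrix.mulVecLin_apply, incM_mulVec] at hf
    obtain ⟨g, hg⟩ := h f hf
    exact ⟨g, by rw [Matrix.mulVecLin_apply, incM_mulVec, hg]⟩
  have e3 := Submodule.finrank_mono e2
  have e4 := LinearMap.finrank_range_le (incM K (c + 1)).mulVecLin
  have e5 := Submodule.finrank_le (LinearMap.range (incM K c).mulVecLin)
  show Module.finrank ℚ ({s : Finset V // s ∈ K ∧ s.card = c + 1} → ℚ) ≤ _
  rw [← e1]
  exact add_le_add e5 (e3.trans e4)

end Det

section Prob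

instance bern_isProb (p : ℝ) : IsProbabilityMeasure (bernoulliBool p) := by
  constructor
  simp only [bernoulliBool, Measure.add_apply, Measure.smul_apply, smul_eq_mul,
    measure_univ, mul_one]
  have h0 : 0 ≤ max 0 (min p 1) := le_max_left _ _
  have h1 : max 0 (min p 1) ≤ 1 := max_le zero_le_one (min_le_right _ _)
  rw [← ENNReal.ofReal_add h0 (by linarith)]
  simp

instance multi_isProb (n : ℕ) (p : ℕ → ℝ) : IsProbabilityMeasure (multiMeasure n p) := by
  unfold multiMeasure; infer_instance

lemma bern_integral (p : ℝ) (hp0 : 0 ≤ p) (hp1 : p ≤ 1) :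
    ∫ b, (if b = true then (1 : ℝ) else 0) ∂(bernoulliBool p) = p := by
  have : max 0 (min p 1) = p := by rw [min_eq_left hp1, max_eq_right hp0]
  unfold bernoulliBool
  rw [this, integral_add_measure, integral_smul_measure, integral_smul_measure]
  · simp [hp0]
  · have : IsFiniteMeasure (ENNReal.ofReal p • Measure.dirac true) :=
      Measure.smul_finite _ ENNReal.ofReal_ne_top
    exact Integrable.of_finite
  · have : IsFiniteMeasure (ENNReal.ofReal (1 - p) • Measure.dirac false) :=
      Measure.smul_finite _ ENNReal.ofReal_ne_top
    exact Integrable.of_finite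

variable {n : ℕ}

noncomputable def coin (ω : MultiIdx n → Bool) (t : MultiIdx n) : ℝ := if ω t = true then 1 else 0

noncomputable def zz (T : Finset (MultiIdx n)) (ω : MultiIdx n → Bool) : ℝ := ∏ t ∈ T, coin ω t

noncomputable def pr (p : ℕ → ℝ) (T : Finset (MultiIdx n)) : ℝ := ∏ t ∈ T, p (t.1.card - 1)

lemma zz_eq (T : Finset (MultiIdx n)) (ω : MultiIdx n → Bool) [Decidable (∀ t ∈ T, ω t = true)] :
    zz T ω = if ∀ t ∈ T, ω t = true then 1 else 0 := by
  unfold zz coin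
  rw [Finset.prod_ite_zero]
  simp

lemma zz_01 (T : Finset (MultiIdx n)) (ω : MultiIdx n → Bool) : zz T ω = 0 ∨ zz T ω = 1 := by
  classical
  rw [zz_eq]; split_ifs <;> simp

lemma zz_union (S T : Finset (MultiIdx n)) (h : Disjoint S T) (ω : MultiIdx n → Bool) :
    zz (S ∪ T) ω = zz S ω * zz T ω := Finset.prod_union h

lemma zz_mul (S T : Finset (MultiIdx n)) (ω : MultiIdx n → Bool) :
    zz S ω * zz T ω = zz (S ∪ T) ω := by
  classical
  rw [zz_eq, zz_eq, zz_eq]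
  by_cases h1 : ∀ t ∈ S, ω t = true
  · by_cases h2 : ∀ t ∈ T, ω t = true
    · rw [if_pos h1, if_pos h2, if_pos]; · simp
      intro t ht; rcases Finset.mem_union.1 ht with h | h
      · exact h1 t h
      · exact h2 t h
    · rw [if_neg h2, mul_zero, if_neg]
      intro h; exact h2 fun t ht => h t (Finset.mem_union.2 (Or.inr ht))
  · rw [if_neg h1, zero_mul, if_neg]
    intro h; exact h1 fun t ht => h t (Finset.mem_union.2 (Or.inl ht))

lemma pr_union (p : ℕ → ℝ) (S T : Finset (MultiIdx n)) (h : Disjoint S T) :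
    pr p (S ∪ T) = pr p S * pr p T := Finset.prod_union h

lemma integrable_any {p : ℕ → ℝ} (F : (MultiIdx n → Bool) → ℝ) :
    Integrable F (multiMeasure n p) := Integrable.of_finite

lemma int_zz (p : ℕ → ℝ) (hp0 : ∀ i, 0 ≤ p i) (hp1 : ∀ i, p i ≤ 1) (T : Finset (MultiIdx n)) :
    ∫ ω, zz T ω ∂(multiMeasure n p) = pr p T := by
  classical
  have h : ∀ ω : MultiIdx n → Bool, zz T ω =
      ∏ t, (if t ∈ T then (if ω t = true then (1 : ℝ) else 0) else 1) := by
    intro ω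
    unfold zz coin
    rw [Finset.prod_ite_mem, Finset.univ_inter]
  simp_rw [h]
  unfold multiMeasure
  rw [MeasureTheory.integral_fintype_prod_eq_prod
    (fun (t : MultiIdx n) (b : Bool) => if t ∈ T then (if b = true then (1 : ℝ) else 0) else 1)]
  unfold pr
  rw [← Finset.univ_inter T, ← Finset.prod_ite_mem]
  refine Finset.prod_congr rfl fun t _ => ?_
  simp only [Finset.univ_inter]
  by_cases ht : t ∈ T
  · simp only [if_pos ht]
    exact bern_integral _ (hp0 _) (hp1 _)
  · simp only [if_neg ht]; exact integral_const _ |>.trans (by rw [probReal_univ, one_smul])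

lemma int_blocks {γ : Type} [DecidableEq γ] (p : ℕ → ℝ) (hp0 : ∀ i, 0 ≤ p i) (hp1 : ∀ i, p i ≤ 1)
    (B : γ → Finset (MultiIdx n)) (a b : γ → ℝ) (E : Finset γ) :
    ∀ (T : Finset (MultiIdx n)), (∀ e ∈ E, ∀ e' ∈ E, e ≠ e' → Disjoint (B e) (B e')) →
    (∀ e ∈ E, Disjoint T (B e)) →
    ∫ ω, zz T ω * ∏ e ∈ E, (a e * zz (B e) ω + b e) ∂(multiMeasure n p) =
      pr p T * ∏ e ∈ E, (a e * pr p (B e) + b e) := by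
  induction E using Finset.induction_on with
  | empty => intro T _ _; simp [int_zz p hp0 hp1]
  | insert e E he ih =>
    intro T hd hT
    have hd' : ∀ e ∈ E, ∀ e' ∈ E, e ≠ e' → Disjoint (B e) (B e') := fun x hx y hy hxy =>
      hd x (Finset.mem_insert_of_mem hx) y (Finset.mem_insert_of_mem hy) hxy
    have h1 := ih (T ∪ B e) hd' (by
      intro x hx
      rw [Finset.disjoint_union_left]
      exact ⟨hT x (Finset.mem_insert_of_mem hx), hd e (Finset.mem_insert_self _ _) x
        (Finset.mem_insert_of_mem hx) (by rintro rfl; exact he hx)⟩)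
    have h2 := ih T hd' (fun x hx => hT x (Finset.mem_insert_of_mem hx))
    have hTe := hT e (Finset.mem_insert_self _ _)
    have : ∀ ω, zz T ω * ∏ e ∈ insert e E, (a e * zz (B e) ω + b e) =
        a e * (zz (T ∪ B e) ω * ∏ e ∈ E, (a e * zz (B e) ω + b e)) +
        b e * (zz T ω * ∏ e ∈ E, (a e * zz (B e) ω + b e)) := by
      intro ω
      rw [Finset.prod_insert he, zz_union _ _ hTe]; ring
    simp_rw [this]
    rw [integral_add (integrable_any _) (integrable_any _), integral_const_mul, integral_const_mul,
      h1, h2, pr_union _ _ _ hTe, Finset.prod_insert he]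
    ring

lemma markov (p : ℕ → ℝ) (F : (MultiIdx n → Bool) → ℝ) (hF : ∀ ω, 0 ≤ F ω) (ε M : ℝ) (hε : 0 < ε)
    (hM : ∫ ω, F ω ∂(multiMeasure n p) ≤ M) :
    multiMeasure n p {ω | ε ≤ F ω} ≤ ENNReal.ofReal (M / ε) := by
  have h := mul_meas_ge_le_integral_of_nonneg (μ := multiMeasure n p) (f := F)
    (Filter.Eventually.of_forall hF) (integrable_any F) ε
  have h2 : (multiMeasure n p).real {ω | ε ≤ F ω} ≤ M / ε := by
    rw [le_div_iff₀ hε]; linarith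
  rw [← ENNReal.ofReal_toReal (measure_ne_top (multiMeasure n p) {ω | ε ≤ F ω})]
  exact ENNReal.ofReal_le_ofReal h2

/-- block of coins -/
def blk (τ g : Finset (Fin n)) : Finset (MultiIdx n) := univ.filter fun t => t.1 \ τ = g

lemma blk_disj (τ g g' : Finset (Fin n)) (h : g ≠ g') : Disjoint (blk τ g) (blk τ g') := by
  rw [Finset.disjoint_left]
  intro t h1 h2
  simp only [blk, Finset.mem_filter] at h1 h2
  exact h (h1.2.symm.trans h2.2)

lemma mem_multi (ω : MultiIdx n → Bool) (s : Finset (Fin n)) :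
    s ∈ multiComplex n ω ↔ ∀ t : MultiIdx n, t.1 ⊆ s → ω t = true := by
  simp [multiComplex]

lemma multi_down (ω : MultiIdx n → Bool) :
    ∀ s ∈ multiComplex n ω, ∀ t, t ⊆ s → t ∈ multiComplex n ω := by
  intro s hs t ht
  rw [mem_multi] at hs ⊢
  intro r hr
  exact hs r (hr.trans ht)

lemma zz_one_iff (T : Finset (MultiIdx n)) (ω : MultiIdx n → Bool) :
    zz T ω = 1 ↔ ∀ t ∈ T, ω t = true := by
  classical
  rw [zz_eq]
  by_cases h : ∀ t ∈ T, ω t = true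
  · rw [if_pos h]; exact ⟨fun _ => h, fun _ => rfl⟩
  · rw [if_neg h]; exact ⟨fun h0 => absurd h0 zero_ne_one, fun h0 => absurd h0 h⟩

/-- insert one vertex -/
lemma mem_insert1 (ω : MultiIdx n → Bool) (τ : Finset (Fin n)) (v : Fin n) (hv : v ∉ τ) :
    insert v τ ∈ multiComplex n ω ↔ τ ∈ multiComplex n ω ∧ zz (blk τ {v}) ω = 1 := by
  rw [mem_multi, mem_multi, zz_one_iff]
  constructor
  · intro h
    refine ⟨fun t ht => h t (ht.trans (Finset.subset_insert _ _)), fun t ht => h t ?_⟩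
    simp only [blk, Finset.mem_filter, Finset.mem_univ, true_and] at ht
    intro x hx
    by_cases hxτ : x ∈ τ
    · exact Finset.mem_insert_of_mem hxτ
    · have : x ∈ t.1 \ τ := Finset.mem_sdiff.2 ⟨hx, hxτ⟩
      rw [ht] at this
      rw [Finset.mem_singleton.1 this]; exact Finset.mem_insert_self _ _
  · rintro ⟨h1, h2⟩ t ht
    by_cases hvt : v ∈ t.1
    · apply h2
      simp only [blk, Finset.mem_filter, Finset.mem_univ, true_and]
      ext x
      simp only [Finset.mem_sdiff, Finset.mem_singleton]
      constructor
      · rintro ⟨hx, hxτ⟩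
        rcases Finset.mem_insert.1 (ht hx) with h | h
        · exact h
        · exact absurd h hxτ
      · rintro rfl; exact ⟨hvt, hv⟩
    · apply h1
      intro x hx
      rcases Finset.mem_insert.1 (ht hx) with h | h
      · subst h; exact absurd hx hvt
      · exact h

lemma mem_insert2 (ω : MultiIdx n → Bool) (τ : Finset (Fin n)) (u v : Fin n) (hu : u ∉ τ)
    (hv : v ∉ τ) (huv : u ≠ v) (h1 : insert u τ ∈ multiComplex n ω)
    (h2 : insert v τ ∈ multiComplex n ω) :
    insert u (insert v τ) ∈ multiComplex n ω ↔ zz (blk τ {u, v}) ω = 1 := by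
  rw [mem_multi] at *
  rw [zz_one_iff]
  constructor
  · intro h t ht
    apply h
    simp only [blk, Finset.mem_filter, Finset.mem_univ, true_and] at ht
    intro x hx
    by_cases hxτ : x ∈ τ
    · simp [hxτ]
    · have : x ∈ t.1 \ τ := Finset.mem_sdiff.2 ⟨hx, hxτ⟩
      rw [ht] at this
      simp only [Finset.mem_insert, Finset.mem_singleton] at this ⊢
      tauto
  · intro h t ht
    by_cases hut : u ∈ t.1
    · by_cases hvt : v ∈ t.1
      · apply h
        simp only [blk, Finset.mem_filter, Finset.mem_univ, true_and]
        ext x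
        simp only [Finset.mem_sdiff, Finset.mem_singleton, Finset.mem_insert]
        constructor
        · rintro ⟨hx, hxτ⟩
          have := ht hx
          simp only [Finset.mem_insert] at this
          tauto
        · rintro (rfl | rfl)
          · exact ⟨hut, hu⟩
          · exact ⟨hvt, hv⟩
      · apply h1
        intro x hx
        have := ht hx
        simp only [Finset.mem_insert] at this ⊢
        rcases this with h | h | h
        · exact Or.inl h
        · subst h; exact absurd hx hvt
        · exact Or.inr h
    · apply h2
      intro x hx
      have := ht hx
      simp only [Finset.mem_insert] at this ⊢
      rcases this with h | h | h
      · subst h; exact absurd hx hut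
      · exact Or.inl h
      · exact Or.inr h

end Prob

section Quad
set_option linter.unusedSectionVars false
variable {V : Type} [Fintype V] [DecidableEq V]

lemma pow_walk (B : Matrix V V ℝ) (L : ℕ) : ∀ i j, (B ^ L) i j = ∑ p : Fin (L + 1) → V,
    if p 0 = i ∧ p (Fin.last L) = j then ∏ k : Fin L, B (p k.castSucc) (p k.succ) else 0 := by
  induction L with
  | zero =>
    intro i j
    rw [← (Equiv.funUnique (Fin 1) V).symm.sum_comp]
    simp only [pow_zero, Finset.univ_eq_empty, Finset.prod_empty]
    rw [Finset.sum_eq_single i]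
    · simp [Matrix.one_apply]
    · intro b _ hb; simp [hb]
    · simp
  | succ L ih =>
    intro i j
    rw [pow_succ', Matrix.mul_apply]
    simp_rw [ih]
    rw [← (Fin.consEquiv (fun _ : Fin (L + 2) => V)).sum_comp, Fintype.sum_prod_type]
    symm
    rw [Finset.sum_eq_single i]
    · symm
      simp_rw [Finset.mul_sum]
      rw [Finset.sum_comm]
      refine Finset.sum_congr rfl fun p _ => ?_
      rw [Finset.sum_eq_single (p 0)]
      · simp only [Fin.consEquiv_apply, Fin.cons_zero, true_and]
        rw [← Fin.succ_last, Fin.cons_succ]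
        split_ifs with h
        · rw [Fin.prod_univ_succ]
          simp only [Fin.castSucc_zero, Fin.cons_zero, Fin.cons_succ]
          rfl
        · simp
      · intro b _ hb
        rw [if_neg (fun h => hb h.1.symm), mul_zero]
      · simp
    · intro b _ hb
      refine Finset.sum_eq_zero fun p _ => ?_
      rw [if_neg]
      simp [Fin.consEquiv_apply, hb]
    · simp

lemma trace_walk (B : Matrix V V ℝ) (L : ℕ) : (B ^ L).trace = ∑ p : Fin (L + 1) → V,
    if p 0 = p (Fin.last L) then ∏ k : Fin L, B (p k.castSucc) (p k.succ) else 0 := by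
  simp only [Matrix.trace, Matrix.diag_apply, pow_walk]
  rw [Finset.sum_comm]
  refine Finset.sum_congr rfl fun p _ => ?_
  rw [Finset.sum_eq_single (p 0)]
  · simp [eq_comm]
  · intro b _ hb
    rw [if_neg (fun h => hb h.1.symm)]
  · simp

lemma walk_card (L : ℕ) : ∀ p : Fin (L + 1) → V, (univ.image p).card ≤
    (univ.image (fun k : Fin L => ({p k.castSucc, p k.succ} : Finset V))).card + 1 := by
  induction L with
  | zero => intro p; simp
  | succ L ih =>
    intro p
    have h := ih (fun k => p k.succ)
    have e1 : univ.image p = insert (p 0) (univ.image fun k : Fin (L + 1) => p k.succ) := by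
      ext x; simp only [Finset.mem_image, Finset.mem_univ, true_and, Finset.mem_insert]
      rw [Fin.exists_fin_succ]; simp [eq_comm]
    have e2 : univ.image (fun k : Fin (L + 1) => ({p k.castSucc, p k.succ} : Finset V)) =
        insert {p 0, p 1} (univ.image (fun k : Fin L =>
          ({p k.castSucc.succ, p k.succ.succ} : Finset V))) := by
      ext x; simp only [Finset.mem_image, Finset.mem_univ, true_and, Finset.mem_insert]
      rw [Fin.exists_fin_succ]; simp [eq_comm]
    rw [e1, e2]
    by_cases hm : p 0 ∈ univ.image fun k : Fin (L + 1) => p k.succ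
    · rw [Finset.insert_eq_of_mem hm]
      refine h.trans ?_
      gcongr
      exact Finset.subset_insert _ _
    · rw [Finset.card_insert_of_notMem hm, Finset.card_insert_of_notMem]
      · omega
      · intro hcon
        simp only [Finset.mem_image, Finset.mem_univ, true_and, not_exists] at hcon hm
        obtain ⟨k, hk⟩ := hcon
        have : p 0 ∈ ({p k.castSucc.succ, p k.succ.succ} : Finset V) := by rw [hk]; simp
        simp only [Finset.mem_insert, Finset.mem_singleton] at this
        rcases this with h | h
        · exact hm _ h.symm
        · exact hm _ h.symm

lemma count_walk (L w : ℕ) : ((univ.filter fun p : Fin (L + 1) → V => (univ.image p).card = w).card)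
    ≤ (Fintype.card V) ^ w * (L + 1) ^ (L + 1) := by
  by_cases hw : w ≤ L + 1
  · have hsub : (univ.filter fun p : Fin (L + 1) → V => (univ.image p).card = w) ⊆
        (univ.powersetCard w : Finset (Finset V)).biUnion
          (fun W => Fintype.piFinset fun _ => W) := by
      intro p hp
      simp only [Finset.mem_filter, Finset.mem_univ, true_and] at hp
      simp only [Finset.mem_biUnion, Finset.mem_powersetCard, Fintype.mem_piFinset]
      exact ⟨univ.image p, ⟨Finset.subset_univ _, hp⟩, fun i => Finset.mem_image_of_mem _ (by simp)⟩
    refine (Finset.card_le_card hsub).trans ?_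
    refine (Finset.card_biUnion_le_card_mul _ _ ((L + 1) ^ (L + 1)) ?_).trans ?_
    · intro W hW
      rw [Fintype.card_piFinset]
      simp only [Finset.prod_const, Finset.card_univ, Fintype.card_fin]
      rw [(Finset.mem_powersetCard.1 hW).2]
      exact Nat.pow_le_pow_left hw _
    · gcongr
      rw [Finset.card_powersetCard]
      exact Nat.choose_le_pow _ _
  · have : (univ.filter fun p : Fin (L + 1) → V => (univ.image p).card = w) = ∅ := by
      rw [Finset.filter_eq_empty_iff]
      intro p _ hp
      have := Finset.card_image_le (s := univ) (f := p)
      simp at this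
      omega
    rw [this]; simp

lemma sum_walk (L r : ℕ) (P q : ℝ) (hP : 0 ≤ P) (hq : 0 ≤ q)
    (h1 : 1 ≤ (Fintype.card V : ℝ) * P * q) :
    (∑ p : Fin (L + 1) → V, if (univ.image p).card ≤ r + 1 then
      P ^ (univ.image p).card * q ^ ((univ.image p).card - 1) else 0) ≤
    (r + 1) * (L + 1) ^ (L + 1) * ((Fintype.card V : ℝ) * P) * ((Fintype.card V : ℝ) * P * q) ^ r := by
  have hW : ∀ p : Fin (L + 1) → V, 1 ≤ (univ.image p).card := by
    intro p
    exact Finset.card_pos.2 ⟨p 0, Finset.mem_image_of_mem _ (by simp)⟩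
  rw [← Finset.sum_filter]
  have hmap : ∀ p ∈ (univ.filter fun p : Fin (L + 1) → V => (univ.image p).card ≤ r + 1),
      (univ.image p).card ∈ Finset.Icc 1 (r + 1) := by
    intro p hp
    simp only [Finset.mem_filter, Finset.mem_univ, true_and] at hp
    exact Finset.mem_Icc.2 ⟨hW p, hp⟩
  rw [← Finset.sum_fiberwise_of_maps_to hmap]
  have : ∀ w ∈ Finset.Icc 1 (r + 1), (∑ p ∈ (univ.filter fun p : Fin (L + 1) → V =>
      (univ.image p).card ≤ r + 1).filter (fun p => (univ.image p).card = w),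
      P ^ (univ.image p).card * q ^ ((univ.image p).card - 1)) ≤
      (L + 1) ^ (L + 1) * ((Fintype.card V : ℝ) * P) * ((Fintype.card V : ℝ) * P * q) ^ r := by
    intro w hw
    rw [Finset.mem_Icc] at hw
    obtain ⟨m, rfl⟩ : ∃ m, w = m + 1 := ⟨w - 1, by omega⟩
    have hb : (∑ p ∈ (univ.filter fun p : Fin (L + 1) → V =>
      (univ.image p).card ≤ r + 1).filter (fun p => (univ.image p).card = m + 1),
      P ^ (univ.image p).card * q ^ ((univ.image p).card - 1)) =
      ((univ.filter fun p : Fin (L + 1) → V =>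
      (univ.image p).card ≤ r + 1).filter (fun p => (univ.image p).card = m + 1)).card •
        (P ^ (m + 1) * q ^ m) := by
      rw [← Finset.sum_const]
      refine Finset.sum_congr rfl fun p hp => ?_
      rw [(Finset.mem_filter.1 hp).2]; simp
    rw [hb, nsmul_eq_mul]
    have hc : (((univ.filter fun p : Fin (L + 1) → V =>
      (univ.image p).card ≤ r + 1).filter (fun p => (univ.image p).card = m + 1)).card : ℝ) ≤
        (Fintype.card V : ℝ) ^ (m + 1) * (L + 1) ^ (L + 1) := by
      have := (Finset.card_le_card (Finset.filter_subset_filter (fun p : Fin (L + 1) → V =>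
        (univ.image p).card = m + 1) (Finset.filter_subset (fun p : Fin (L + 1) → V =>
        (univ.image p).card ≤ r + 1) univ))).trans (count_walk (V := V) L (m + 1))
      exact_mod_cast this
    calc _ ≤ ((Fintype.card V : ℝ) ^ (m + 1) * (L + 1) ^ (L + 1)) * (P ^ (m + 1) * q ^ m) :=
          mul_le_mul_of_nonneg_right hc (by positivity)
      _ = (L + 1) ^ (L + 1) * ((Fintype.card V : ℝ) * P) * ((Fintype.card V : ℝ) * P * q) ^ m := by
          rw [mul_pow, mul_pow]; ring
      _ ≤ _ := by
          gcongr
          omega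
  refine (Finset.sum_le_sum this).trans ?_
  rw [Finset.sum_const]
  simp only [Nat.card_Icc, nsmul_eq_mul]
  push_cast
  apply le_of_eq
  ring

lemma quad_trace (B : Matrix V V ℝ) (hB : Bᵀ = B) (s : ℕ) (lam : ℝ) (hlam : 0 < lam)
    (htr : (B ^ (2 ^ (s + 1))).trace < lam ^ (2 ^ (s + 1))) (f : V → ℝ) :
    f ⬝ᵥ (B *ᵥ f) ≤ lam * ∑ u, f u ^ 2 := by
  set N := ∑ u, f u ^ 2 with hN
  have hN0 : 0 ≤ N := Finset.sum_nonneg fun _ _ => sq_nonneg _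
  rcases hN0.eq_or_lt with h0 | hNpos
  · have : f = 0 := by
      funext u
      have := (Finset.sum_eq_zero_iff_of_nonneg (fun _ _ => sq_nonneg _)).1 (hN.symm.trans h0.symm) u
        (Finset.mem_univ _)
      exact pow_eq_zero_iff (two_ne_zero) |>.1 this
    rw [this, ← h0]; simp
  have hsym : ∀ m : ℕ, (B ^ m)ᵀ = B ^ m := by
    intro m; rw [Matrix.transpose_pow, hB]
  let a : ℕ → ℝ := fun j => f ⬝ᵥ (B ^ (2 ^ j) *ᵥ f)
  have hsq : ∀ j, a (j + 1) = ∑ u, ((B ^ (2 ^ j) *ᵥ f) u) ^ 2 := by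
    intro j
    simp only [a]
    rw [pow_succ, mul_two, pow_add, ← Matrix.mulVec_mulVec, Matrix.dotProduct_mulVec,
      ← Matrix.mulVec_transpose, hsym]
    simp [dotProduct, sq]
  have hcs : ∀ j, a j ^ 2 ≤ N * a (j + 1) := by
    intro j
    rw [hsq]
    exact Finset.sum_mul_sq_le_sq_mul_sq _ _ _
  have hmain : ∀ j, a 0 ^ (2 ^ (j + 1)) * N ≤ N ^ (2 ^ (j + 1)) * a (j + 1) := by
    intro j
    induction j with
    | zero =>
      have := hcs 0
      simp only [zero_add, pow_one] at *
      nlinarith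
    | succ j ih =>
      have h1 := hcs (j + 1)
      have hp : 0 ≤ a 0 ^ (2 ^ (j + 1)) := by
        rw [pow_succ 2 j, mul_comm, pow_mul]; positivity
      have h2 : (a 0 ^ (2 ^ (j + 1)) * N) ^ 2 ≤ (N ^ (2 ^ (j + 1)) * a (j + 1)) ^ 2 :=
        pow_le_pow_left₀ (by positivity) ih 2
      rw [mul_pow, mul_pow, ← pow_mul, ← pow_mul, ← pow_succ] at h2
      have h3 : (a 0 ^ 2 ^ (j + 1 + 1) * N) * N ≤ (N ^ (2 ^ (j + 1 + 1)) * a (j + 1 + 1)) * N := by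
        calc _ = a 0 ^ 2 ^ (j + 1 + 1) * N ^ 2 := by ring
          _ ≤ _ := h2
          _ ≤ N ^ (2 ^ (j + 1 + 1)) * (N * a (j + 1 + 1)) :=
              mul_le_mul_of_nonneg_left h1 (by positivity)
          _ = _ := by ring
      exact le_of_mul_le_mul_right h3 hNpos
  have hlast : a (s + 1) ≤ N * (B ^ (2 ^ (s + 1))).trace := by
    rw [hsq]
    have ht : (B ^ (2 ^ (s + 1))).trace = ∑ u, ∑ v, (B ^ (2 ^ s)) u v ^ 2 := by
      rw [pow_succ 2 s, mul_two, pow_add]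
      simp only [Matrix.trace, Matrix.diag_apply, Matrix.mul_apply]
      refine Finset.sum_congr rfl fun u _ => Finset.sum_congr rfl fun v _ => ?_
      have : (B ^ (2 ^ s)) v u = (B ^ (2 ^ s)) u v := by
        conv_lhs => rw [← hsym]
        rfl
      rw [this, sq]
    rw [ht, Finset.mul_sum]
    refine Finset.sum_le_sum fun u _ => ?_
    rw [mul_comm]
    exact Finset.sum_mul_sq_le_sq_mul_sq _ _ _
  have h4 : a 0 ^ (2 ^ (s + 1)) ≤ N ^ (2 ^ (s + 1)) * (B ^ (2 ^ (s + 1))).trace := by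
    have := (hmain s).trans (mul_le_mul_of_nonneg_left hlast (by positivity))
    refine le_of_mul_le_mul_right (this.trans (le_of_eq ?_)) hNpos
    ring
  by_contra hcon
  push Not at hcon
  have ha0 : a 0 = f ⬝ᵥ (B *ᵥ f) := by simp [a]
  rw [← ha0] at hcon
  have h5 : (lam * N) ^ (2 ^ (s + 1)) ≤ a 0 ^ (2 ^ (s + 1)) :=
    pow_le_pow_left₀ (by positivity) hcon.le _
  rw [mul_pow] at h5
  have : 0 < N ^ (2 ^ (s + 1)) := by positivity
  nlinarith
end Quad

section Tr
variable {n : ℕ}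

noncomputable def Bm (τ : Finset (Fin n)) (q : ℝ) (ω : MultiIdx n → Bool) : Matrix (Fin n) (Fin n) ℝ :=
  Matrix.of fun u v => if u ≠ v ∧ u ∉ τ ∧ v ∉ τ then
    (zz (blk τ {u}) ω * zz (blk τ {v}) ω) * (zz (blk τ {u, v}) ω - q) else 0

lemma Bm_symm (τ : Finset (Fin n)) (q : ℝ) (ω : MultiIdx n → Bool) : (Bm τ q ω)ᵀ = Bm τ q ω := by
  ext u v
  simp only [Matrix.transpose_apply, Bm, Matrix.of_apply]
  by_cases h : u ≠ v ∧ u ∉ τ ∧ v ∉ τ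
  · rw [if_pos h, if_pos ⟨h.1.symm, h.2.2, h.2.1⟩, Finset.pair_comm]; ring
  · rw [if_neg h, if_neg (by tauto)]

lemma zz_prod {κ : Type} [DecidableEq κ] (s : Finset κ) (A : κ → Finset (MultiIdx n))
    (ω : MultiIdx n → Bool) : ∏ k ∈ s, zz (A k) ω = zz (s.biUnion A) ω := by
  induction s using Finset.induction_on with
  | empty => simp [zz]
  | insert k s hk ih => rw [Finset.prod_insert hk, ih, zz_mul, Finset.biUnion_insert]

lemma factor_bound (q : ℝ) (h0 : 0 ≤ q) (h1 : q ≤ 1) (m : ℕ) (hm : 2 ≤ m) :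
    |((1 - q) ^ m - (-q) ^ m) * q + (-q) ^ m| ≤ q := by
  have e : ((1 - q) ^ m - (-q) ^ m) * q + (-q) ^ m = q * (1 - q) ^ m + (1 - q) * (-q) ^ m := by ring
  rw [e]
  have a1 : (1 - q) ^ m ≤ (1 - q) ^ 2 := pow_le_pow_of_le_one (by linarith) (by linarith) hm
  have a2 : |(-q) ^ m| ≤ q ^ 2 := by
    rw [abs_pow, abs_neg, abs_of_nonneg h0]
    exact pow_le_pow_of_le_one h0 h1 hm
  have a3 : 0 ≤ (1 - q) ^ m := pow_nonneg (by linarith) _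
  calc |q * (1 - q) ^ m + (1 - q) * (-q) ^ m| ≤ |q * (1 - q) ^ m| + |(1 - q) * (-q) ^ m| := abs_add_le _ _
    _ = q * (1 - q) ^ m + (1 - q) * |(-q) ^ m| := by
        rw [abs_mul, abs_mul, abs_of_nonneg h0, abs_of_nonneg a3, abs_of_nonneg (by linarith : 0 ≤ 1 - q)]
    _ ≤ q * (1 - q) ^ 2 + (1 - q) * q ^ 2 := by
        have : 0 ≤ 1 - q := by linarith
        gcongr
    _ ≤ q := by nlinarith [mul_nonneg h0 h0]

lemma walk_term (p : ℕ → ℝ) (hp0 : ∀ i, 0 ≤ p i) (hp1 : ∀ i, p i ≤ 1) (τ : Finset (Fin n)) (P q : ℝ)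
    (hP0 : 0 ≤ P) (hq0 : 0 ≤ q) (hq1 : q ≤ 1)
    (hP : ∀ u, u ∉ τ → pr p (blk τ {u}) = P)
    (hq : ∀ u v, u ∉ τ → v ∉ τ → u ≠ v → pr p (blk τ {u, v}) = q) (L : ℕ) (hL : 1 ≤ L)
    (w : Fin (L + 1) → Fin n) :
    ∫ ω, ∏ k : Fin L, Bm τ q ω (w k.castSucc) (w k.succ) ∂(multiMeasure n p) ≤
      if (univ.image w).card ≤ L / 2 + 1 then
        P ^ (univ.image w).card * q ^ ((univ.image w).card - 1) else 0 := by
  classical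
  have hR : 0 ≤ if (univ.image w).card ≤ L / 2 + 1 then
        P ^ (univ.image w).card * q ^ ((univ.image w).card - 1) else 0 := by
    split_ifs <;> positivity
  by_cases hbad : ∃ k : Fin L, ¬ (w k.castSucc ≠ w k.succ ∧ w k.castSucc ∉ τ ∧ w k.succ ∉ τ)
  · obtain ⟨k, hk⟩ := hbad
    have : ∀ ω, ∏ k : Fin L, Bm τ q ω (w k.castSucc) (w k.succ) = 0 := by
      intro ω
      refine Finset.prod_eq_zero (Finset.mem_univ k) ?_
      rw [Bm, Matrix.of_apply, if_neg hk]
    simp_rw [this]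
    simpa using hR
  push Not at hbad
  set W := univ.image w with hW
  let ed : Fin L → Finset (Fin n) := fun k => {w k.castSucc, w k.succ}
  set E := univ.image ed with hE
  let m : Finset (Fin n) → ℕ := fun e => (univ.filter fun k => ed k = e).card
  let a : Finset (Fin n) → ℝ := fun e => (1 - q) ^ (m e) - (-q) ^ (m e)
  let b : Finset (Fin n) → ℝ := fun e => (-q) ^ (m e)
  have hvert : ∀ i : Fin (L + 1), (∃ k : Fin L, i = k.castSucc ∨ i = k.succ) := by
    intro i
    obtain ⟨L', rfl⟩ : ∃ L', L = L' + 1 := ⟨L - 1, by omega⟩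
    rcases Fin.eq_zero_or_eq_succ i with h | ⟨j, h⟩
    · exact ⟨0, Or.inl (by rw [h]; rfl)⟩
    · exact ⟨j, Or.inr h⟩
  have hWτ : ∀ u ∈ W, u ∉ τ := by
    intro u hu
    obtain ⟨i, _, rfl⟩ := Finset.mem_image.1 hu
    obtain ⟨k, h | h⟩ := hvert i
    · rw [h]; exact (hbad k).2.1
    · rw [h]; exact (hbad k).2.2
  have hEcard : ∀ e ∈ E, e.card = 2 := by
    intro e he
    obtain ⟨k, _, rfl⟩ := Finset.mem_image.1 he
    exact Finset.card_pair (hbad k).1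
  have hEq : ∀ e ∈ E, pr p (blk τ e) = q := by
    intro e he
    obtain ⟨k, _, rfl⟩ := Finset.mem_image.1 he
    exact hq _ _ (hbad k).2.1 (hbad k).2.2 (hbad k).1
  let T0 : Finset (MultiIdx n) := W.biUnion fun u => blk τ {u}
  have hform : ∀ ω, ∏ k : Fin L, Bm τ q ω (w k.castSucc) (w k.succ) =
      zz T0 ω * ∏ e ∈ E, (a e * zz (blk τ e) ω + b e) := by
    intro ω
    have h1 : ∀ k : Fin L, Bm τ q ω (w k.castSucc) (w k.succ) =
        (zz (blk τ {w k.castSucc} ∪ blk τ {w k.succ}) ω) * (zz (blk τ (ed k)) ω - q) := by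
      intro k
      rw [Bm, Matrix.of_apply, if_pos (hbad k), zz_mul]
    simp_rw [h1]
    rw [Finset.prod_mul_distrib, zz_prod]
    congr 1
    · congr 1
      ext t
      simp only [T0, Finset.mem_biUnion, Finset.mem_univ, true_and, Finset.mem_union, hW,
        Finset.mem_image]
      constructor
      · rintro ⟨k, h | h⟩
        · exact ⟨_, ⟨_, rfl⟩, h⟩
        · exact ⟨_, ⟨_, rfl⟩, h⟩
      · rintro ⟨u, ⟨i, rfl⟩, h⟩
        obtain ⟨k, h' | h'⟩ := hvert i
        · exact ⟨k, Or.inl (h' ▸ h)⟩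
        · exact ⟨k, Or.inr (h' ▸ h)⟩
    · rw [Finset.prod_comp (fun e => zz (blk τ e) ω - q) ed]
      refine Finset.prod_congr rfl fun e _ => ?_
      show (zz (blk τ e) ω - q) ^ (m e) = _
      simp only [a, b]
      rcases zz_01 (blk τ e) ω with h | h <;> rw [h] <;> ring
  simp_rw [hform]
  rw [int_blocks p hp0 hp1 (fun e => blk τ e) a b E T0
    (fun e _ e' _ h => blk_disj τ e e' h)
    (by
      intro e he
      simp only [T0, Finset.disjoint_biUnion_left]
      intro u _
      apply blk_disj
      intro h
      have := hEcard e he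
      rw [← h] at this
      simp at this)]
  have hprT : pr p T0 = P ^ W.card := by
    unfold pr
    simp only [T0]
    rw [Finset.prod_biUnion]
    · rw [← Finset.prod_const]
      exact Finset.prod_congr rfl fun u hu => hP u (hWτ u hu)
    · intro u _ v _ huv
      apply blk_disj
      simpa using huv
  rw [hprT]
  have hprE : ∏ e ∈ E, (a e * pr p (blk τ e) + b e) = ∏ e ∈ E, (a e * q + b e) :=
    Finset.prod_congr rfl fun e he => by rw [hEq e he]
  rw [hprE]
  by_cases h1 : ∃ e ∈ E, m e = 1
  · obtain ⟨e, he, hm⟩ := h1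
    rw [Finset.prod_eq_zero he, mul_zero]
    · exact hR
    · simp only [a, b, hm]; ring
  push Not at h1
  have hm1 : ∀ e ∈ E, 1 ≤ m e := by
    intro e he
    obtain ⟨k, _, rfl⟩ := Finset.mem_image.1 he
    exact Finset.card_pos.2 ⟨k, by simp⟩
  have hm2 : ∀ e ∈ E, 2 ≤ m e := by
    intro e he
    have := h1 e he
    have := hm1 e he
    omega
  have hEL : 2 * E.card ≤ L := by
    have h3 := Finset.card_eq_sum_card_image ed univ
    simp only [Finset.card_univ, Fintype.card_fin] at h3
    rw [h3, mul_comm, ← smul_eq_mul]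
    exact Finset.card_nsmul_le_sum _ _ _ hm2
  have hWE : W.card ≤ E.card + 1 := walk_card L w
  rw [if_pos (by omega)]
  refine mul_le_mul_of_nonneg_left ?_ (by positivity)
  calc ∏ e ∈ E, (a e * q + b e) ≤ |∏ e ∈ E, (a e * q + b e)| := le_abs_self _
    _ = ∏ e ∈ E, |a e * q + b e| := Finset.abs_prod _ _
    _ ≤ ∏ e ∈ E, q := Finset.prod_le_prod (fun _ _ => abs_nonneg _)
        (fun e he => factor_bound q hq0 hq1 (m e) (hm2 e he))
    _ = q ^ E.card := by rw [Finset.prod_const]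
    _ ≤ q ^ (W.card - 1) := pow_le_pow_of_le_one hq0 hq1 (by omega)

lemma exp_trace (p : ℕ → ℝ) (hp0 : ∀ i, 0 ≤ p i) (hp1 : ∀ i, p i ≤ 1) (τ : Finset (Fin n)) (P q : ℝ)
    (hP0 : 0 ≤ P) (hq0 : 0 ≤ q) (hq1 : q ≤ 1) (hD : 1 ≤ n * P * q)
    (hP : ∀ u, u ∉ τ → pr p (blk τ {u}) = P)
    (hq : ∀ u v, u ∉ τ → v ∉ τ → u ≠ v → pr p (blk τ {u, v}) = q) (L : ℕ) (hL : 1 ≤ L) :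
    ∫ ω, (Bm τ q ω ^ L).trace ∂(multiMeasure n p) ≤
      ((L / 2 : ℕ) + 1) * (L + 1) ^ (L + 1) * (n * P) * (n * P * q) ^ (L / 2) := by
  simp_rw [trace_walk]
  rw [integral_finsetSum _ (fun _ _ => integrable_any _)]
  have h := sum_walk (V := Fin n) L (L / 2) P q hP0 hq0 (by simpa using hD)
  simp only [Fintype.card_fin] at h
  refine le_trans (Finset.sum_le_sum fun w _ => ?_) h
  by_cases hc : w 0 = w (Fin.last L)
  · simp only [if_pos hc]
    exact walk_term p hp0 hp1 τ P q hP0 hq0 hq1 hP hq L hL w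
  · simp only [if_neg hc, integral_zero]
    split_ifs <;> positivity

/-- spectral bad event -/
lemma spec_prob (p : ℕ → ℝ) (hp0 : ∀ i, 0 ≤ p i) (hp1 : ∀ i, p i ≤ 1) (τ : Finset (Fin n)) (P q : ℝ)
    (hP0 : 0 ≤ P) (hP1 : P ≤ 1) (hq0 : 0 ≤ q) (hq1 : q ≤ 1) (hD : 1 ≤ n * P * q)
    (hP : ∀ u, u ∉ τ → pr p (blk τ {u}) = P)
    (hq : ∀ u v, u ∉ τ → v ∉ τ → u ≠ v → pr p (blk τ {u, v}) = q) (s : ℕ) (K : ℝ) (hK : 0 < K) :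
    multiMeasure n p {ω | (n * P * q / K) ^ (2 ^ (s + 1)) ≤ (Bm τ q ω ^ (2 ^ (s + 1))).trace} ≤
      ENNReal.ofReal (((2 ^ s + 1) * (2 ^ (s + 1) + 1) ^ (2 ^ (s + 1) + 1) * K ^ (2 ^ (s + 1))) *
        (n * ((n * P * q) ^ (2 ^ s))⁻¹)) := by
  have h := exp_trace p hp0 hp1 τ P q hP0 hq0 hq1 hD hP hq (2 ^ (s + 1)) Nat.one_le_two_pow
  have hD0 : 0 < (n : ℝ) * P * q := by linarith
  refine (markov p _ ?_ _ _ (by positivity) h).trans ?_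
  · intro ω
    have e : (2 : ℕ) ^ (s + 1) = 2 ^ s + 2 ^ s := by ring
    rw [e, pow_add]
    have hs : (Bm τ q ω ^ (2 ^ s))ᵀ = Bm τ q ω ^ (2 ^ s) := by
      rw [Matrix.transpose_pow, Bm_symm]
    simp only [Matrix.trace, Matrix.diag_apply, Matrix.mul_apply]
    refine Finset.sum_nonneg fun u _ => Finset.sum_nonneg fun v _ => ?_
    have : (Bm τ q ω ^ (2 ^ s)) v u = (Bm τ q ω ^ (2 ^ s)) u v := by
      conv_lhs => rw [← hs]
      rfl
    rw [this]
    exact mul_self_nonneg _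
  · apply ENNReal.ofReal_le_ofReal
    have e : (2 : ℕ) ^ (s + 1) / 2 = 2 ^ s := by rw [pow_succ]; simp
    have e2 : (2 : ℕ) ^ (s + 1) = 2 ^ s + 2 ^ s := by ring
    rw [e]
    have e3 : ∀ x : ℝ, x ^ (2 ^ (s + 1)) = x ^ (2 ^ s) * x ^ (2 ^ s) := by
      intro x; rw [← pow_add, ← e2]
    rw [div_pow, e3 (n * P * q)]
    push_cast
    have hDs : 0 < ((n : ℝ) * P * q) ^ (2 ^ s) := by positivity
    generalize ((n : ℝ) * P * q) ^ (2 ^ s) = Z at *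
    have e4 : ((2 : ℝ) ^ s + 1) * (2 ^ (s + 1) + 1) ^ (2 ^ (s + 1) + 1) * (n * P) * Z /
        (Z * Z / K ^ (2 ^ (s + 1))) = ((2 ^ s + 1) * (2 ^ (s + 1) + 1) ^ (2 ^ (s + 1) + 1) * K ^ (2 ^ (s + 1))) *
        ((n * P) * Z⁻¹) := by
      field_simp
    rw [e4]
    gcongr
    exact mul_le_of_le_one_right (Nat.cast_nonneg _) hP1

/-- from trace to hspec -/
lemma spec_good (ω : MultiIdx n → Bool) (τ : Finset (Fin n)) (q : ℝ) (hq : 0 ≤ q) (s : ℕ) (lam : ℝ)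
    (hlam : 0 < lam) (htr : (Bm τ q ω ^ (2 ^ (s + 1))).trace < lam ^ (2 ^ (s + 1)))
    (φ : Fin n → ℝ) (hφ : ∀ u, φ u ≠ 0 → u ∉ τ ∧ insert u τ ∈ multiComplex n ω) (h0 : ∑ u, φ u = 0) :
    (∑ v, ∑ u, if u ≠ v ∧ insert u (insert v τ) ∈ multiComplex n ω then φ u * φ v else 0)
      ≤ lam * ∑ u, φ u ^ 2 := by
  have h1 := quad_trace (Bm τ q ω) (Bm_symm τ q ω) s lam hlam htr φ
  have h2 : ∀ u v, (if u ≠ v ∧ insert u (insert v τ) ∈ multiComplex n ω then φ u * φ v else 0) =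
      φ v * (Bm τ q ω v u * φ u) + q * (φ u * φ v) - (if u = v then q * (φ u * φ v) else 0) := by
    intro u v
    by_cases hu : φ u = 0
    · simp [hu]
    by_cases hv : φ v = 0
    · simp [hv]
    obtain ⟨hu1, hu2⟩ := hφ u hu
    obtain ⟨hv1, hv2⟩ := hφ v hv
    by_cases huv : u = v
    · subst huv
      simp [Bm]
    · have hzu := ((mem_insert1 ω τ u hu1).1 hu2).2
      have hzv := ((mem_insert1 ω τ v hv1).1 hv2).2
      have hB : Bm τ q ω v u = (zz (blk τ {v}) ω * zz (blk τ {u}) ω) * (zz (blk τ {v, u}) ω - q) := by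
        rw [Bm, Matrix.of_apply, if_pos ⟨Ne.symm huv, hv1, hu1⟩]
      rw [hB, hzu, hzv, if_neg (show ¬ (u = v) from huv), Finset.pair_comm v u]
      by_cases hm : insert u (insert v τ) ∈ multiComplex n ω
      · rw [if_pos ⟨huv, hm⟩, (mem_insert2 ω τ u v hu1 hv1 huv hu2 hv2).1 hm]; ring
      · rw [if_neg (by tauto)]
        have : zz (blk τ {u, v}) ω = 0 := by
          rcases zz_01 (blk τ {u, v}) ω with h | h
          · exact h
          · exact absurd ((mem_insert2 ω τ u v hu1 hv1 huv hu2 hv2).2 h) hm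
        rw [this]; ring
  have h3 : (∑ v, ∑ u, if u ≠ v ∧ insert u (insert v τ) ∈ multiComplex n ω then φ u * φ v else 0) =
      φ ⬝ᵥ (Bm τ q ω *ᵥ φ) - q * ∑ u, φ u ^ 2 := by
    simp_rw [h2, Finset.sum_sub_distrib, Finset.sum_add_distrib]
    have e1 : ∑ v, ∑ u, q * (φ u * φ v) = 0 := by
      simp_rw [← Finset.mul_sum, ← Finset.sum_mul, h0]; simp
    rw [e1]
    simp only [dotProduct, Matrix.mulVec, Finset.mul_sum, Finset.sum_ite_eq', Finset.mem_univ, if_true,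
      add_zero]
    congr 1
    refine Finset.sum_congr rfl fun u _ => by rw [sq]
  rw [h3]
  have : 0 ≤ q * ∑ u, φ u ^ 2 := mul_nonneg hq (Finset.sum_nonneg fun _ _ => sq_nonneg _)
  linarith

/-- degree bound -/
lemma deg_prob (p : ℕ → ℝ) (hp0 : ∀ i, 0 ≤ p i) (hp1 : ∀ i, p i ≤ 1) (σ : Finset (Fin n)) (P : ℝ)
    (hP0 : 0 ≤ P) (hP : ∀ u, u ∉ σ → pr p (blk σ {u}) = P) (hn : 2 * σ.card ≤ n) :
    multiMeasure n p {ω | ((univ.filter fun v => v ∉ σ ∧ zz (blk σ {v}) ω = 1).card : ℝ) ≤ n * P / 8} ≤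
      ENNReal.ofReal (Real.exp (-(n * P / 8))) := by
  classical
  let F : (MultiIdx n → Bool) → ℝ := fun ω => ∏ v ∈ σᶜ, ((-1 / 2 : ℝ) * zz (blk σ {v}) ω + 1)
  have hint : ∫ ω, F ω ∂(multiMeasure n p) ≤ Real.exp (-(n * P / 4)) := by
    have h := int_blocks p hp0 hp1 (fun v : Fin n => blk σ {v}) (fun _ => (-1 / 2 : ℝ)) (fun _ => 1) σᶜ ∅
      (by
        intro e _ e' _ h
        apply blk_disj
        simpa using h) (by simp)
    have e0 : ∀ ω : MultiIdx n → Bool, zz ∅ ω = 1 := by intro ω; simp [zz]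
    have e1 : pr p (∅ : Finset (MultiIdx n)) = 1 := by simp [pr]
    simp only [e0, e1, one_mul] at h
    show ∫ ω, ∏ v ∈ σᶜ, ((-1 / 2 : ℝ) * zz (blk σ {v}) ω + 1) ∂(multiMeasure n p) ≤ _
    rw [h]
    have hP1 : σᶜ.Nonempty → P ≤ 1 := by
      rintro ⟨u, hu⟩
      rw [← hP u (by simpa using hu)]
      exact Finset.prod_le_one (fun _ _ => hp0 _) (fun _ _ => hp1 _)
    calc ∏ v ∈ σᶜ, ((-1 / 2 : ℝ) * pr p (blk σ {v}) + 1) ≤ ∏ v ∈ σᶜ, Real.exp (-(P / 2)) := by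
          refine Finset.prod_le_prod ?_ ?_
          · intro v hv
            rw [hP v (by simpa using hv)]
            have := hP1 ⟨v, hv⟩
            linarith
          · intro v hv
            rw [hP v (by simpa using hv)]
            have := Real.add_one_le_exp (-(P / 2))
            linarith
      _ = Real.exp (-(P / 2)) ^ (n - σ.card) := by
          rw [Finset.prod_const, Finset.card_compl, Fintype.card_fin]
      _ = Real.exp (-((n - σ.card : ℕ) * P / 2)) := by
          rw [← Real.exp_nat_mul]; congr 1; ring
      _ ≤ _ := by
          apply Real.exp_le_exp.2
          rw [Nat.cast_sub (by omega)]
          have : (2 : ℝ) * σ.card ≤ n := by exact_mod_cast hn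
          nlinarith
  have hF0 : ∀ ω, 0 ≤ F ω := by
    intro ω
    refine Finset.prod_nonneg fun v _ => ?_
    rcases zz_01 (blk σ {v}) ω with h | h <;> rw [h] <;> norm_num
  have hm := markov p F hF0 (Real.exp (-(n * P / 8))) _ (Real.exp_pos _) hint
  refine (measure_mono ?_).trans (hm.trans ?_)
  · intro ω hω
    simp only [Set.mem_ofPred_eq] at hω ⊢
    have e : F ω = (1 / 2 : ℝ) ^ (univ.filter fun v => v ∉ σ ∧ zz (blk σ {v}) ω = 1).card := by
      have : (univ.filter fun v => v ∉ σ ∧ zz (blk σ {v}) ω = 1) =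
          σᶜ.filter fun v => zz (blk σ {v}) ω = 1 := by ext v; simp
      rw [this, ← Finset.prod_const, Finset.prod_filter]
      refine Finset.prod_congr rfl fun v _ => ?_
      rcases zz_01 (blk σ {v}) ω with h | h <;> rw [h] <;> norm_num
    rw [e]
    have h2 : Real.exp (-1) ≤ 1 / 2 := by
      rw [Real.exp_neg, one_div]
      apply inv_anti₀ (by norm_num)
      have := Real.add_one_le_exp (1 : ℝ)
      linarith
    calc Real.exp (-(n * P / 8)) ≤ Real.exp (-((univ.filter fun v => v ∉ σ ∧ zz (blk σ {v}) ω = 1).card : ℝ)) :=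
          Real.exp_le_exp.2 (by linarith)
      _ = Real.exp (-1) ^ (univ.filter fun v => v ∉ σ ∧ zz (blk σ {v}) ω = 1).card := by
          rw [← Real.exp_nat_mul]; congr 1; ring
      _ ≤ _ := pow_le_pow_left₀ (Real.exp_pos _).le h2 _
  · apply ENNReal.ofReal_le_ofReal
    rw [← Real.exp_sub]
    apply Real.exp_le_exp.2
    linarith

end Tr

section Expo

variable {n : ℕ}

noncomputable def aa (α : ℕ → ℝ) (m : ℕ) : ℝ := if 2 ≤ m then α (m - 1) else 0

noncomputable def GG (m : ℕ) (f : ℕ → ℝ) : ℝ := ∑ s ∈ (Finset.range m).powerset, f s.card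

lemma GG_eq (m : ℕ) (f : ℕ → ℝ) : GG m f = ∑ j ∈ Finset.range (m + 1), (m.choose j : ℝ) * f j := by
  unfold GG
  rw [Finset.sum_powerset_apply_card]
  simp

lemma GG_powerset {β : Type} (τ : Finset β) (f : ℕ → ℝ) :
    ∑ s ∈ τ.powerset, f s.card = GG τ.card f := by
  rw [GG_eq, Finset.sum_powerset_apply_card]
  simp

lemma GG_succ (m : ℕ) (f : ℕ → ℝ) : GG (m + 1) f = GG m f + GG m (fun j => f (j + 1)) := by
  unfold GG
  rw [Finset.range_add_one, Finset.sum_powerset_insert Finset.notMem_range_self]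
  congr 1
  refine Finset.sum_congr rfl fun s hs => ?_
  rw [Finset.card_insert_of_notMem]
  intro h
  have := Finset.mem_powerset.1 hs h
  simp at this

lemma aa_nonneg (α : ℕ → ℝ) (hα : ∀ i, 0 ≤ α i) (m : ℕ) : 0 ≤ aa α m := by
  unfold aa; split_ifs <;> simp [hα]

/-- the sum in the statement -/
lemma GG_S (α : ℕ → ℝ) (m : ℕ) :
    GG m (fun j => aa α (j + 1)) = ∑ i ∈ Finset.Icc 1 m, α i * (m.choose i : ℝ) := by
  rw [GG_eq, Finset.sum_range_succ']
  have : Finset.Icc 1 m = (Finset.range m).image (· + 1) := by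
    ext x; simp only [Finset.mem_Icc, Finset.mem_image, Finset.mem_range]
    constructor
    · rintro ⟨h1, h2⟩; exact ⟨x - 1, by omega, by omega⟩
    · rintro ⟨y, hy, rfl⟩; omega
  rw [this, Finset.sum_image (by intro x _ y _ h; simpa using h)]
  simp [aa, mul_comm]

lemma sum_idx (α : ℕ → ℝ) (A : Finset (Finset (Fin n))) :
    ∑ t ∈ univ.filter (fun t : MultiIdx n => t.1 ∈ A), α (t.1.card - 1) = ∑ s ∈ A, aa α s.card := by
  unfold aa
  rw [← Finset.sum_filter]
  refine Finset.sum_bij (fun t _ => t.1) ?_ ?_ ?_ ?_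
  · intro t ht
    simp only [Finset.mem_filter, Finset.mem_univ, true_and] at ht ⊢
    exact ⟨ht, t.2⟩
  · intro a _ b _ h; exact Subtype.ext h
  · intro b hb
    simp only [Finset.mem_filter] at hb
    exact ⟨⟨b, hb.2⟩, by simp [hb.1], rfl⟩
  · intro a _; rfl

lemma sum_blk (α : ℕ → ℝ) (τ g : Finset (Fin n)) (hg : Disjoint g τ) :
    ∑ t ∈ blk τ g, α (t.1.card - 1) = GG τ.card (fun j => aa α (j + g.card)) := by
  have e : blk τ g = univ.filter (fun t : MultiIdx n => t.1 ∈ τ.powerset.image (· ∪ g)) := by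
    ext t
    simp only [blk, Finset.mem_filter, Finset.mem_univ, true_and, Finset.mem_image,
      Finset.mem_powerset]
    constructor
    · intro h
      refine ⟨t.1 ∩ τ, Finset.inter_subset_right, ?_⟩
      rw [← h, Finset.union_comm, Finset.sdiff_union_inter]
    · rintro ⟨s, hs, h⟩
      rw [← h, Finset.union_sdiff_distrib, Finset.sdiff_eq_empty_iff_subset.2 hs, Finset.empty_union,
        Finset.sdiff_eq_self_of_disjoint hg]
  rw [e, sum_idx, Finset.sum_image, ← GG_powerset]
  · refine Finset.sum_congr rfl fun s hs => ?_
    rw [Finset.card_union_of_disjoint]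
    exact (hg.mono_right (Finset.mem_powerset.1 hs)).symm
  · intro a ha b hb h
    have ha' := Finset.mem_powerset.1 ha
    have hb' := Finset.mem_powerset.1 hb
    have key : ∀ s, s ⊆ τ → (s ∪ g) \ g = s := fun s hs =>
      Finset.union_sdiff_cancel_right (hg.mono_right hs).symm
    rw [← key a ha', ← key b hb']
    simp only at h
    rw [h]

lemma pr_exp (α : ℕ → ℝ) (hn : 1 ≤ n) (T : Finset (MultiIdx n)) :
    pr (fun i => (n : ℝ) ^ (-(α i))) T = (n : ℝ) ^ (-∑ t ∈ T, α (t.1.card - 1)) := by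
  unfold pr
  rw [← Finset.sum_neg_distrib, Real.rpow_sum_of_pos (by exact_mod_cast hn)]

lemma pr_blk (α : ℕ → ℝ) (hn : 1 ≤ n) (τ g : Finset (Fin n)) (hg : Disjoint g τ) :
    pr (fun i => (n : ℝ) ^ (-(α i))) (blk τ g) = (n : ℝ) ^ (-GG τ.card (fun j => aa α (j + g.card))) := by
  rw [pr_exp α hn, sum_blk α τ g hg]

end Expo

section Part1

lemma whp (α : ℕ → ℝ) (G : ∀ n : ℕ, Set (MultiIdx n → Bool)) (r : ℕ → ℝ)
    (hr : Tendsto r atTop (nhds 0))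
    (h : ∀ᶠ n : ℕ in atTop, multiMeasure n (fun i => (n : ℝ) ^ (-(α i))) (G n)ᶜ ≤ ENNReal.ofReal (r n)) :
    Tendsto (fun n : ℕ => multiMeasure n (fun i => (n : ℝ) ^ (-(α i))) (G n)) atTop
      (nhds (1 : ENNReal)) := by
  have h1 : Tendsto (fun n : ℕ => multiMeasure n (fun i => (n : ℝ) ^ (-(α i))) (G n)ᶜ) atTop
      (nhds 0) := by
    have h2 : Tendsto (fun n => ENNReal.ofReal (r n)) atTop (nhds 0) := by
      simpa using ENNReal.tendsto_ofReal hr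
    exact tendsto_of_tendsto_of_tendsto_of_le_of_le' tendsto_const_nhds h2
      (Eventually.of_forall fun _ => zero_le) h
  have h3 : ∀ n : ℕ, multiMeasure n (fun i => (n : ℝ) ^ (-(α i))) (G n) =
      1 - multiMeasure n (fun i => (n : ℝ) ^ (-(α i))) (G n)ᶜ := by
    intro n
    have := prob_compl_eq_one_sub (μ := multiMeasure n (fun i => (n : ℝ) ^ (-(α i))))
      (s := (G n)ᶜ) (Set.Finite.measurableSet (Set.toFinite _))
    rwa [compl_compl] at this
  simp_rw [h3]
  have := ENNReal.Tendsto.sub (tendsto_const_nhds (x := (1 : ENNReal)) (f := atTop)) h1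
    (Or.inl ENNReal.one_ne_top)
  simpa using this

lemma union_le {n : ℕ} (p : ℕ → ℝ) (j : ℕ) (B : Finset (Fin n) → Set (MultiIdx n → Bool)) (b : ℝ)
    (hb : 0 ≤ b)
    (h : ∀ σ : Finset (Fin n), σ.card = j → multiMeasure n p (B σ) ≤ ENNReal.ofReal b) :
    multiMeasure n p (⋃ σ ∈ Finset.powersetCard j (univ : Finset (Fin n)), B σ) ≤
      ENNReal.ofReal ((n : ℝ) ^ j * b) := by
  refine (measure_biUnion_finset_le _ _).trans ?_
  refine (Finset.sum_le_card_nsmul _ _ (ENNReal.ofReal b) ?_).trans ?_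
  · intro σ hσ
    exact h σ (Finset.mem_powersetCard.1 hσ).2
  · rw [Finset.card_powersetCard, Finset.card_univ, Fintype.card_fin, nsmul_eq_mul,
      ← ENNReal.ofReal_natCast, ← ENNReal.ofReal_mul (by positivity)]
    apply ENNReal.ofReal_le_ofReal
    apply mul_le_mul_of_nonneg_right _ hb
    exact_mod_cast Nat.choose_le_pow n j

lemma p_nonneg (α : ℕ → ℝ) (n : ℕ) (i : ℕ) : 0 ≤ (n : ℝ) ^ (-(α i)) := by positivity

lemma p_le_one (α : ℕ → ℝ) (hα : ∀ i, 0 ≤ α i) (n : ℕ) (hn : 1 ≤ n) (i : ℕ) :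
    (n : ℝ) ^ (-(α i)) ≤ 1 :=
  Real.rpow_le_one_of_one_le_of_nonpos (by exact_mod_cast hn) (by linarith [hα i])

lemma part1_bound (c : ℕ) (α : ℕ → ℝ) (hα : ∀ i, 0 ≤ α i) (ε : ℝ) (hε : 0 < ε)
    (hS : GG (c + 1) (fun j => aa α (j + 1)) = 1 - ε) (s : ℕ) (n : ℕ) (hn : 2 * (c + 1) ≤ n) :
    multiMeasure n (fun i => (n : ℝ) ^ (-(α i))) {ω | HomologyZero (multiComplex n ω) c ℚ}ᶜ ≤
      ENNReal.ofReal ((n : ℝ) ^ (c + 1) * Real.exp (-((n : ℝ) ^ ε / 8)) +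
        (n : ℝ) ^ c * (((2 ^ s + 1) * (2 ^ (s + 1) + 1) ^ (2 ^ (s + 1) + 1) *
          (16 * (c + 1)) ^ (2 ^ (s + 1))) * (n * (((n : ℝ) ^ ε) ^ (2 ^ s))⁻¹))) := by
  classical
  have hn1 : 1 ≤ n := by omega
  have hnR : (1 : ℝ) ≤ n := by exact_mod_cast hn1
  have hn0 : (0 : ℝ) < n := by linarith
  set p : ℕ → ℝ := fun i => (n : ℝ) ^ (-(α i)) with hp
  have hp0 : ∀ i, 0 ≤ p i := p_nonneg α n
  have hp1 : ∀ i, p i ≤ 1 := p_le_one α hα n hn1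
  have hGnn : ∀ m k, 0 ≤ GG m (fun j => aa α (j + k)) := fun m k =>
    Finset.sum_nonneg fun _ _ => aa_nonneg α hα _
  set q : ℝ := (n : ℝ) ^ (-GG c (fun j => aa α (j + 2))) with hq
  set P : ℝ := (n : ℝ) ^ (-GG c (fun j => aa α (j + 1))) with hP
  set P' : ℝ := (n : ℝ) ^ (-GG (c + 1) (fun j => aa α (j + 1))) with hP'
  set D : ℝ := (n : ℝ) ^ ε with hD
  have hDP' : n * P' = D := by
    rw [hP', hD, hS, ← Real.rpow_one_add' hn0.le (by linarith)]
    congr 1; ring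
  have hDPq : n * P * q = D := by
    rw [← hDP', hP', GG_succ, mul_assoc, hP, hq, ← Real.rpow_add hn0]
    congr 2
    ring_nf
  have hD1 : 1 ≤ D := Real.one_le_rpow hnR hε.le
  have hPle : ∀ x : ℝ, 0 ≤ x → (n : ℝ) ^ (-x) ≤ 1 := fun x hx =>
    Real.rpow_le_one_of_one_le_of_nonpos hnR (by linarith)
  let K : ℝ := 16 * (c + 1)
  have hK : 0 < K := by positivity
  let B1 : Finset (Fin n) → Set (MultiIdx n → Bool) := fun σ =>
    {ω | ((univ.filter fun v => v ∉ σ ∧ zz (blk σ {v}) ω = 1).card : ℝ) ≤ n * P' / 8}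
  let B2 : Finset (Fin n) → Set (MultiIdx n → Bool) := fun τ =>
    {ω | (n * P * q / K) ^ (2 ^ (s + 1)) ≤ (Bm τ q ω ^ (2 ^ (s + 1))).trace}
  have u1 := union_le p (c + 1) B1 (Real.exp (-(n * P' / 8))) (Real.exp_pos _).le (by
    intro σ hσ
    refine deg_prob p hp0 hp1 σ P' (by positivity) ?_ (by omega)
    intro u hu
    rw [hp, pr_blk α hn1 σ {u} (by simpa using hu), hσ, Finset.card_singleton])
  have u2 := union_le p c B2 (((2 ^ s + 1) * (2 ^ (s + 1) + 1) ^ (2 ^ (s + 1) + 1) *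
          K ^ (2 ^ (s + 1))) * (n * ((n * P * q) ^ (2 ^ s))⁻¹)) (by positivity) (by
    intro τ hτ
    refine spec_prob p hp0 hp1 τ P q (by positivity) (hPle _ (hGnn _ _)) (by positivity)
      (hPle _ (hGnn _ _)) (by rw [hDPq]; exact hD1) ?_ ?_ s K hK
    · intro u hu
      rw [hp, pr_blk α hn1 τ {u} (by simpa using hu), hτ, Finset.card_singleton]
    · intro u v hu hv huv
      rw [hp, pr_blk α hn1 τ {u, v} (by simp [hu, hv]), hτ, Finset.card_pair huv])
  rw [ENNReal.ofReal_add (by positivity) (by positivity)]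
  rw [hDP'] at u1
  rw [hDPq] at u2
  refine le_trans (le_trans (measure_mono ?_) (measure_union_le _ _)) (add_le_add u1 u2)
  intro ω hω
  by_contra hcon
  apply hω
  simp only [Set.mem_union, not_or, Set.mem_iUnion, not_exists] at hcon
  obtain ⟨g1, g2⟩ := hcon
  show HomologyZero (multiComplex n ω) c ℚ
  refine homology_zero_of _ (multi_down ω) c (D / K) (D / 8) ?_ ?_ ?_
  · show D / (16 * (c + 1)) * (c + 1) < D / 8
    have : D / (16 * (c + 1)) * (c + 1) = D / 16 := by field_simp
    rw [this]; linarith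
  · intro σ hσ hc
    have := g1 σ (Finset.mem_powersetCard.2 ⟨Finset.subset_univ _, hc⟩)
    simp only [B1, Set.mem_ofPred_eq, not_le, hDP'] at this
    refine this.le.trans (le_of_eq ?_)
    congr 2
    ext v
    simp only [Finset.mem_filter, Finset.mem_univ, true_and]
    constructor
    · rintro ⟨h1, h2⟩; exact ⟨h1, (mem_insert1 ω σ v h1).2 ⟨hσ, h2⟩⟩
    · rintro ⟨h1, h2⟩; exact ⟨h1, ((mem_insert1 ω σ v h1).1 h2).2⟩
  · intro τ hτ φ hφ h0
    have := g2 τ (Finset.mem_powersetCard.2 ⟨Finset.subset_univ _, hτ⟩)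
    simp only [B2, Set.mem_ofPred_eq, not_le, hDPq] at this
    exact spec_good ω τ q (by positivity) s (D / K) (by positivity) this φ hφ h0

lemma part1_lim (c : ℕ) (ε : ℝ) (hε : 0 < ε) (s : ℕ) (hs : (c : ℝ) + 1 < ε * 2 ^ s) (C : ℝ) :
    Tendsto (fun n : ℕ => (n : ℝ) ^ (c + 1) * Real.exp (-((n : ℝ) ^ ε / 8)) +
        (n : ℝ) ^ c * (C * (n * (((n : ℝ) ^ ε) ^ (2 ^ s))⁻¹))) atTop (nhds 0) := by
  have l1 : Tendsto (fun n : ℕ => (n : ℝ) ^ ε) atTop atTop :=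
    (tendsto_rpow_atTop hε).comp tendsto_natCast_atTop_atTop
  have t1 := (tendsto_rpow_mul_exp_neg_mul_atTop_nhds_zero (((c : ℝ) + 1) / ε) (1 / 8)
    (by norm_num)).comp l1
  have t2 := ((tendsto_rpow_neg_atTop (y := ε * 2 ^ s - (c + 1)) (by linarith)).comp
    (tendsto_natCast_atTop_atTop (R := ℝ))).const_mul C
  rw [mul_zero] at t2
  have t := t1.add t2
  rw [add_zero] at t
  refine t.congr' ?_
  filter_upwards [eventually_ge_atTop 1] with n hn
  have hn0 : (0 : ℝ) < n := by exact_mod_cast hn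
  simp only [Function.comp]
  congr 1
  · rw [← Real.rpow_mul hn0.le, mul_div_cancel₀ _ hε.ne', ← Real.rpow_natCast]
    push_cast
    congr 2; ring
  · rw [neg_sub, Real.rpow_sub hn0, Real.rpow_mul hn0.le, Real.rpow_add hn0, Real.rpow_one,
      Real.rpow_natCast]
    have : ((n : ℝ) ^ ε) ^ ((2 : ℝ) ^ s) = ((n : ℝ) ^ ε) ^ (2 ^ s) := by
      rw [← Real.rpow_natCast _ (2 ^ s)]; push_cast; rfl
    rw [this, div_eq_mul_inv]; ring

lemma part1 (c : ℕ) (α : ℕ → ℝ) (hα : ∀ i, 0 ≤ α i)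
    (hS : GG (c + 1) (fun j => aa α (j + 1)) < 1) :
    Tendsto (fun n : ℕ => multiMeasure n (fun i => (n : ℝ) ^ (-(α i)))
            {ω | HomologyZero (multiComplex n ω) c ℚ}) atTop (nhds (1 : ENNReal)) := by
  have hε : 0 < 1 - GG (c + 1) (fun j => aa α (j + 1)) := by linarith
  obtain ⟨s, hs⟩ := pow_unbounded_of_one_lt
    (((c : ℝ) + 1) / (1 - GG (c + 1) (fun j => aa α (j + 1)))) (one_lt_two)
  rw [div_lt_iff₀ hε, mul_comm] at hs
  refine whp α _ _ (part1_lim c _ hε s hs ((2 ^ s + 1) * (2 ^ (s + 1) + 1) ^ (2 ^ (s + 1) + 1) *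
          (16 * (c + 1)) ^ (2 ^ (s + 1)))) ?_
  filter_upwards [eventually_ge_atTop (2 * (c + 1))] with n hn
  exact part1_bound c α hα _ hε (by ring) s n hn

end Part1

section Part2

variable {n : ℕ}

/-- all coins below a set -/
def cf (σ : Finset (Fin n)) : Finset (MultiIdx n) := univ.filter fun t => t.1 ∈ σ.powerset

noncomputable def Fc (m : ℕ) (ω : MultiIdx n → Bool) : ℝ :=
  ∑ σ ∈ Finset.powersetCard m (univ : Finset (Fin n)), zz (cf σ) ω

lemma zz_cf (σ : Finset (Fin n)) (ω : MultiIdx n → Bool) :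
    zz (cf σ) ω = 1 ↔ σ ∈ multiComplex n ω := by
  rw [zz_one_iff, mem_multi]
  simp [cf]

lemma Fc_eq (m : ℕ) (ω : MultiIdx n → Bool) :
    Fc m ω = (((multiComplex n ω).filter fun s => s.card = m).card : ℝ) := by
  classical
  unfold Fc
  have h : ∀ σ : Finset (Fin n), zz (cf σ) ω = if σ ∈ multiComplex n ω then 1 else 0 := by
    intro σ
    by_cases hs : σ ∈ multiComplex n ω
    · rw [if_pos hs, (zz_cf σ ω).2 hs]
    · rw [if_neg hs]
      rcases zz_01 (cf σ) ω with h | h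
      · exact h
      · exact absurd ((zz_cf σ ω).1 h) hs
  simp_rw [h]
  rw [← Finset.sum_filter, Finset.sum_const, nsmul_eq_mul, mul_one]
  congr 2
  ext s
  simp only [Finset.mem_filter, Finset.mem_powersetCard, Finset.subset_univ, true_and]
  tauto

noncomputable def QQ (α : ℕ → ℝ) (m : ℕ) : ℝ := GG m (aa α)

lemma sum_cf (α : ℕ → ℝ) (σ : Finset (Fin n)) :
    ∑ t ∈ cf σ, α (t.1.card - 1) = QQ α σ.card := by
  unfold cf QQ
  rw [sum_idx, GG_powerset]

lemma pr_cf (α : ℕ → ℝ) (hn : 1 ≤ n) (σ : Finset (Fin n)) :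
    pr (fun i => (n : ℝ) ^ (-(α i))) (cf σ) = (n : ℝ) ^ (-QQ α σ.card) := by
  rw [pr_exp α hn, sum_cf]

lemma cf_inter (σ σ' : Finset (Fin n)) : cf σ ∩ cf σ' = cf (σ ∩ σ') := by
  ext t
  simp only [cf, Finset.mem_inter, Finset.mem_filter, Finset.mem_univ, true_and, Finset.mem_powerset,
    Finset.subset_inter_iff]

lemma pr_cf2 (α : ℕ → ℝ) (hn : 1 ≤ n) (σ σ' : Finset (Fin n)) :
    pr (fun i => (n : ℝ) ^ (-(α i))) (cf σ ∪ cf σ') =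
      (n : ℝ) ^ (QQ α (σ ∩ σ').card - QQ α σ.card - QQ α σ'.card) := by
  rw [pr_exp α hn]
  congr 1
  have := Finset.sum_union_inter (s₁ := cf σ) (s₂ := cf σ') (f := fun t : MultiIdx n => α (t.1.card - 1))
  rw [cf_inter, sum_cf, sum_cf, sum_cf] at this
  linarith

lemma QQ_zero (α : ℕ → ℝ) : QQ α 0 = 0 := by simp [QQ, GG, aa]
lemma QQ_one (α : ℕ → ℝ) : QQ α 1 = 0 := by
  unfold QQ; rw [GG_eq]; simp [Finset.sum_range_succ, aa]

/-- number of sets with given intersection -/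
lemma count_inter (σ : Finset (Fin n)) (m j : ℕ) :
    ((Finset.powersetCard m (univ : Finset (Fin n))).filter fun σ' => (σ ∩ σ').card = j).card ≤
      2 ^ σ.card * n ^ (m - j) := by
  classical
  calc _ ≤ (σ.powerset ×ˢ Finset.powersetCard (m - j) (univ : Finset (Fin n))).card := by
        refine Finset.card_le_card_of_injOn (fun σ' => (σ ∩ σ', σ' \ σ)) ?_ ?_
        · intro σ' h
          simp only [Finset.coe_filter, Finset.mem_powersetCard, Set.mem_ofPred_eq] at h
          simp only [Finset.coe_product, Set.mem_prod, Finset.mem_coe, Finset.mem_powerset,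
            Finset.mem_powersetCard]
          refine ⟨Finset.inter_subset_left, Finset.subset_univ _, ?_⟩
          rw [Finset.card_sdiff, h.1.2, h.2]
        · intro a _ b _ h
          simp only [Prod.mk.injEq] at h
          rw [← Finset.sdiff_union_inter a σ, ← Finset.sdiff_union_inter b σ, h.2,
            Finset.inter_comm a, Finset.inter_comm b, h.1]
    _ ≤ _ := by
        rw [Finset.card_product, Finset.card_powerset, Finset.card_powersetCard, Finset.card_univ,
          Fintype.card_fin]
        exact Nat.mul_le_mul_left _ (Nat.choose_le_pow _ _)

noncomputable def MM (α : ℕ → ℝ) (n m : ℕ) : ℝ := (n.choose m : ℝ) * (n : ℝ) ^ (-QQ α m)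
noncomputable def NN (α : ℕ → ℝ) (m : ℕ) : ℝ := m - QQ α m

lemma var_eq (α : ℕ → ℝ) (hα : ∀ i, 0 ≤ α i) (hn : 1 ≤ n) (m : ℕ) :
    ∫ ω, (Fc m ω - MM α n m) ^ 2 ∂(multiMeasure n (fun i => (n : ℝ) ^ (-(α i)))) =
      ∑ σ ∈ Finset.powersetCard m (univ : Finset (Fin n)),
        ∑ σ' ∈ Finset.powersetCard m (univ : Finset (Fin n)),
          ((n : ℝ) ^ (QQ α (σ ∩ σ').card - 2 * QQ α m) - (n : ℝ) ^ (- (2 * QQ α m))) := by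
  have hn0 : (0 : ℝ) < n := by exact_mod_cast hn
  have hp0 := p_nonneg α n
  have hp1 := p_le_one α hα n hn
  have hM : MM α n m = ∑ σ ∈ Finset.powersetCard m (univ : Finset (Fin n)), (n : ℝ) ^ (-QQ α m) := by
    rw [Finset.sum_const, Finset.card_powersetCard, Finset.card_univ, Fintype.card_fin, nsmul_eq_mul]
    rfl
  have h1 : ∀ ω : MultiIdx n → Bool, (Fc m ω - MM α n m) ^ 2 =
      ∑ σ ∈ Finset.powersetCard m (univ : Finset (Fin n)),
        ∑ σ' ∈ Finset.powersetCard m (univ : Finset (Fin n)),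
          (zz (cf σ ∪ cf σ') ω - (n : ℝ) ^ (-QQ α m) * zz (cf σ) ω - (n : ℝ) ^ (-QQ α m) * zz (cf σ') ω
            + (n : ℝ) ^ (-QQ α m) * (n : ℝ) ^ (-QQ α m)) := by
    intro ω
    rw [hM, Fc, ← Finset.sum_sub_distrib, sq, Finset.sum_mul_sum]
    refine Finset.sum_congr rfl fun σ _ => Finset.sum_congr rfl fun σ' _ => ?_
    rw [← zz_mul]; ring
  simp_rw [h1]
  rw [integral_finsetSum _ fun _ _ => integrable_any _]
  refine Finset.sum_congr rfl fun σ hσ => ?_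
  rw [integral_finsetSum _ fun _ _ => integrable_any _]
  refine Finset.sum_congr rfl fun σ' hσ' => ?_
  rw [integral_add (integrable_any _) (integrable_any _), integral_sub (integrable_any _) (integrable_any _),
    integral_sub (integrable_any _) (integrable_any _), integral_const_mul, integral_const_mul,
    int_zz _ hp0 hp1, int_zz _ hp0 hp1, int_zz _ hp0 hp1, integral_const, probReal_univ, one_smul,
    pr_cf α hn, pr_cf α hn, pr_cf2 α hn, (Finset.mem_powersetCard.1 hσ).2,
    (Finset.mem_powersetCard.1 hσ').2, ← Real.rpow_add hn0]
  ring_nf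

lemma var_bound (α : ℕ → ℝ) (hα : ∀ i, 0 ≤ α i) (hn : 1 ≤ n) (m : ℕ) :
    ∫ ω, (Fc m ω - MM α n m) ^ 2 ∂(multiMeasure n (fun i => (n : ℝ) ^ (-(α i)))) ≤
      2 ^ m * ∑ j ∈ Finset.Icc 2 m, (n : ℝ) ^ (2 * NN α m - NN α j) := by
  classical
  have hn0 : (0 : ℝ) < n := by exact_mod_cast hn
  rw [var_eq α hα hn m]
  have key : ∀ σ ∈ Finset.powersetCard m (univ : Finset (Fin n)),
      ∑ σ' ∈ Finset.powersetCard m (univ : Finset (Fin n)),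
          ((n : ℝ) ^ (QQ α (σ ∩ σ').card - 2 * QQ α m) - (n : ℝ) ^ (- (2 * QQ α m))) ≤
      ∑ j ∈ Finset.Icc 2 m, (2 : ℝ) ^ m * (n : ℝ) ^ (2 * NN α m - NN α j - m) := by
    intro σ hσ
    have hσc := (Finset.mem_powersetCard.1 hσ).2
    calc _ ≤ ∑ σ' ∈ Finset.powersetCard m (univ : Finset (Fin n)),
          ∑ j ∈ Finset.Icc 2 m, (if (σ ∩ σ').card = j then (n : ℝ) ^ (QQ α j - 2 * QQ α m) else 0) := by
          refine Finset.sum_le_sum fun σ' hσ' => ?_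
          rw [Finset.sum_ite_eq]
          have hle : (σ ∩ σ').card ≤ m := hσc ▸ Finset.card_le_card Finset.inter_subset_left
          by_cases h2 : 2 ≤ (σ ∩ σ').card
          · rw [if_pos (Finset.mem_Icc.2 ⟨h2, hle⟩)]
            have : 0 ≤ (n : ℝ) ^ (- (2 * QQ α m)) := by positivity
            linarith
          · rw [if_neg (by simp; omega)]
            have : QQ α (σ ∩ σ').card = 0 := by
              have : (σ ∩ σ').card = 0 ∨ (σ ∩ σ').card = 1 := by omega
              rcases this with h | h <;> rw [h]
              · exact QQ_zero α
              · exact QQ_one α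
            rw [this, zero_sub, sub_self]
      _ = ∑ j ∈ Finset.Icc 2 m, ∑ σ' ∈ Finset.powersetCard m (univ : Finset (Fin n)),
            (if (σ ∩ σ').card = j then (n : ℝ) ^ (QQ α j - 2 * QQ α m) else 0) := Finset.sum_comm
      _ ≤ _ := by
          refine Finset.sum_le_sum fun j hj => ?_
          have hjm := (Finset.mem_Icc.1 hj).2
          rw [← Finset.sum_filter, Finset.sum_const, nsmul_eq_mul]
          have hc : ((((Finset.powersetCard m (univ : Finset (Fin n))).filter
              fun σ' => (σ ∩ σ').card = j).card : ℕ) : ℝ) ≤ 2 ^ m * (n : ℝ) ^ ((m : ℝ) - j) := by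
            have := count_inter σ m j
            rw [hσc] at this
            rw [← Nat.cast_sub hjm, Real.rpow_natCast]
            exact_mod_cast this
          refine (mul_le_mul_of_nonneg_right hc (by positivity)).trans (le_of_eq ?_)
          rw [mul_assoc, ← Real.rpow_add hn0]
          congr 2
          unfold NN; ring
  refine (Finset.sum_le_card_nsmul _ _ _ key).trans ?_
  rw [Finset.card_powersetCard, Finset.card_univ, Fintype.card_fin, nsmul_eq_mul, ← Finset.mul_sum,
    mul_left_comm]
  apply mul_le_mul_of_nonneg_left _ (by positivity)
  rw [Finset.mul_sum]
  refine Finset.sum_le_sum fun j hj => ?_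
  have hc : ((n.choose m : ℕ) : ℝ) ≤ (n : ℝ) ^ (m : ℝ) := by
    rw [Real.rpow_natCast]; exact_mod_cast Nat.choose_le_pow n m
  refine (mul_le_mul_of_nonneg_right hc (by positivity)).trans (le_of_eq ?_)
  rw [← Real.rpow_add hn0]
  congr 1; ring

lemma cheb (α : ℕ → ℝ) (hα : ∀ i, 0 ≤ α i) (hn : 1 ≤ n) (m : ℕ) (δ x : ℝ) (hδ : 0 < δ) :
    multiMeasure n (fun i => (n : ℝ) ^ (-(α i))) {ω | δ * (n : ℝ) ^ x ≤ |Fc m ω - MM α n m|} ≤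
      ENNReal.ofReal (2 ^ m / δ ^ 2 * ∑ j ∈ Finset.Icc 2 m, (n : ℝ) ^ (2 * NN α m - NN α j - 2 * x)) := by
  have hn0 : (0 : ℝ) < n := by exact_mod_cast hn
  have h := markov (fun i => (n : ℝ) ^ (-(α i))) (fun ω => (Fc m ω - MM α n m) ^ 2)
    (fun _ => sq_nonneg _) ((δ * (n : ℝ) ^ x) ^ 2) _ (by positivity) (var_bound α hα hn m)
  refine (measure_mono ?_).trans (h.trans (le_of_eq ?_))
  · intro ω hω
    simp only [Set.mem_ofPred_eq] at hω ⊢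
    rw [← sq_abs (Fc m ω - MM α n m)]
    exact pow_le_pow_left₀ (by positivity) hω 2
  · congr 1
    have : ∀ j, (n : ℝ) ^ (2 * NN α m - NN α j - 2 * x) =
        (n : ℝ) ^ (2 * NN α m - NN α j) * (((n : ℝ) ^ x) ^ 2)⁻¹ := by
      intro j
      rw [Real.rpow_sub hn0, two_mul x, Real.rpow_add hn0, div_eq_mul_inv]; ring
    simp_rw [this]
    rw [← Finset.sum_mul]
    field_simp

end Part2

section Part2b

lemma QQ_succ (α : ℕ → ℝ) (m : ℕ) : QQ α (m + 1) = QQ α m + GG m (fun j => aa α (j + 1)) :=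
  GG_succ m (aa α)

lemma NN_succ (α : ℕ → ℝ) (m : ℕ) : NN α (m + 1) = NN α m + (1 - GG m (fun j => aa α (j + 1))) := by
  unfold NN; rw [QQ_succ]; push_cast; ring

lemma GG_mono (α : ℕ → ℝ) (hα : ∀ i, 0 ≤ α i) :
    Monotone fun m => GG m (fun j => aa α (j + 1)) := by
  refine monotone_nat_of_le_succ fun m => ?_
  rw [GG_succ]
  have : 0 ≤ GG m (fun j => aa α (j + 1 + 1)) := Finset.sum_nonneg fun _ _ => aa_nonneg α hα _
  linarith

lemma NN_lt (α : ℕ → ℝ) (hα : ∀ i, 0 ≤ α i) (c : ℕ) (hS : GG c (fun j => aa α (j + 1)) < 1) :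
    ∀ d j, j + d = c + 1 → 1 ≤ d → NN α j < NN α (c + 1) := by
  intro d
  induction d with
  | zero => intro j _ h; omega
  | succ d ih =>
    intro j hj _
    have h1 : NN α j < NN α (j + 1) := by
      rw [NN_succ]
      have : GG j (fun j => aa α (j + 1)) ≤ GG c (fun j => aa α (j + 1)) := GG_mono α hα (by omega)
      linarith
    rcases Nat.eq_zero_or_pos d with hd | hd
    · subst hd
      have : j = c := by omega
      subst this; exact h1
    · exact h1.trans (ih (j + 1) (by omega) hd)

lemma NN_pos (α : ℕ → ℝ) (hα : ∀ i, 0 ≤ α i) (c : ℕ) (hS : GG c (fun j => aa α (j + 1)) < 1) :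
    ∀ j, j ≤ c → 0 < NN α (j + 1) := by
  intro j hj
  have := NN_lt α hα j (lt_of_le_of_lt (GG_mono α hα hj) hS) (j + 1) 0 (by omega) (by omega)
  have h0 : NN α 0 = 0 := by simp [NN, QQ_zero]
  rwa [h0] at this

lemma cheb_lim (α : ℕ → ℝ) (hα : ∀ i, 0 ≤ α i) (c : ℕ) (hS : GG c (fun j => aa α (j + 1)) < 1)
    (hS1 : 1 ≤ GG (c + 1) (fun j => aa α (j + 1))) (m : ℕ) (hm : m ≤ c + 2) (C : ℝ) :
    Tendsto (fun n : ℕ => C * ∑ j ∈ Finset.Icc 2 m,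
      (n : ℝ) ^ (2 * NN α m - NN α j - 2 * NN α (c + 1))) atTop (nhds 0) := by
  have h : Tendsto (fun n : ℕ => ∑ j ∈ Finset.Icc 2 m,
      (n : ℝ) ^ (2 * NN α m - NN α j - 2 * NN α (c + 1))) atTop (nhds (∑ j ∈ Finset.Icc 2 m, 0)) := by
    refine tendsto_finsetSum _ fun j hj => ?_
    rw [Finset.mem_Icc] at hj
    have hk2 : NN α (c + 2) ≤ NN α (c + 1) := by
      rw [NN_succ α (c + 1)]; linarith
    have hmk : NN α m ≤ NN α (c + 1) := by
      rcases Nat.lt_trichotomy m (c + 1) with h | h | h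
      · exact (NN_lt α hα c hS (c + 1 - m) m (by omega) (by omega)).le
      · rw [h]
      · have : m = c + 2 := by omega
        rw [this]; exact hk2
    have hneg : 2 * NN α m - NN α j - 2 * NN α (c + 1) < 0 := by
      by_cases hjc : j ≤ c + 1
      · have := NN_pos α hα c hS (j - 1) (by omega)
        rw [Nat.sub_add_cancel (by omega)] at this
        linarith
      · have e1 : j = c + 2 := by omega
        have e2 : m = c + 2 := by omega
        have := NN_pos α hα c hS c le_rfl
        rw [e1, e2]
        linarith
    have t := (tendsto_rpow_neg_atTop (y := -(2 * NN α m - NN α j - 2 * NN α (c + 1)))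
      (by linarith)).comp (tendsto_natCast_atTop_atTop (R := ℝ))
    rw [neg_neg] at t
    exact t
  rw [Finset.sum_const_zero] at h
  simpa using h.const_mul C

lemma MM_lower (α : ℕ → ℝ) (n k : ℕ) (hn : 2 * k ≤ n) (hn1 : 1 ≤ n) :
    (1 / (2 ^ k * (k.factorial : ℝ))) * (n : ℝ) ^ (NN α k) ≤ MM α n k := by
  have hn0 : (0 : ℝ) < n := by exact_mod_cast hn1
  unfold MM NN
  rw [sub_eq_add_neg, Real.rpow_add hn0, Real.rpow_natCast, ← mul_assoc]
  apply mul_le_mul_of_nonneg_right _ (by positivity)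
  have h := Nat.pow_sub_le_descFactorial n k
  rw [Nat.descFactorial_eq_factorial_mul_choose] at h
  have h2 : ((n : ℝ) / 2) ^ k ≤ (k.factorial : ℝ) * n.choose k := by
    calc ((n : ℝ) / 2) ^ k ≤ ((n + 1 - k : ℕ) : ℝ) ^ k := by
          apply pow_le_pow_left₀ (by positivity)
          rw [Nat.cast_sub (by omega)]
          have : (2 : ℝ) * k ≤ n := by exact_mod_cast hn
          push_cast; linarith
      _ ≤ _ := by exact_mod_cast h
  rw [div_pow] at h2
  have hf : (0 : ℝ) < k.factorial := by exact_mod_cast k.factorial_pos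
  rw [one_div, mul_inv]
  calc _ = ((n : ℝ) ^ k / 2 ^ k) * (k.factorial : ℝ)⁻¹ := by rw [div_eq_mul_inv]; ring
    _ ≤ ((k.factorial : ℝ) * n.choose k) * (k.factorial : ℝ)⁻¹ :=
        mul_le_mul_of_nonneg_right h2 (by positivity)
    _ = _ := by field_simp

lemma MM_upper (α : ℕ → ℝ) (n k : ℕ) (hn1 : 1 ≤ n) : MM α n k ≤ (n : ℝ) ^ (NN α k) := by
  have hn0 : (0 : ℝ) < n := by exact_mod_cast hn1
  unfold MM NN
  rw [sub_eq_add_neg, Real.rpow_add hn0, Real.rpow_natCast]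
  apply mul_le_mul_of_nonneg_right _ (by positivity)
  exact_mod_cast Nat.choose_le_pow n k

lemma MM_half (α : ℕ → ℝ) (n k : ℕ) (hk : 1 ≤ k) (hn1 : 1 ≤ n)
    (hS1 : 1 ≤ GG k (fun j => aa α (j + 1))) : MM α n (k + 1) ≤ MM α n k / 2 := by
  have hnR : (1 : ℝ) ≤ n := by exact_mod_cast hn1
  have hn0 : (0 : ℝ) < n := by linarith
  have h1 : (n.choose (k + 1) : ℝ) * 2 ≤ n.choose k * n := by
    have h := Nat.choose_succ_right_eq n k
    have : n.choose (k + 1) * 2 ≤ n.choose k * n := by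
      calc n.choose (k + 1) * 2 ≤ n.choose (k + 1) * (k + 1) := Nat.mul_le_mul_left _ (by omega)
        _ = n.choose k * (n - k) := h
        _ ≤ _ := Nat.mul_le_mul_left _ (by omega)
    exact_mod_cast this
  have h2 : (n : ℝ) * (n : ℝ) ^ (-QQ α (k + 1)) ≤ (n : ℝ) ^ (-QQ α k) := by
    calc (n : ℝ) * (n : ℝ) ^ (-QQ α (k + 1)) = (n : ℝ) ^ (1 + -QQ α (k + 1)) := by
          rw [Real.rpow_add hn0, Real.rpow_one]
      _ ≤ _ := Real.rpow_le_rpow_of_exponent_le hnR (by rw [QQ_succ]; linarith)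
  unfold MM
  have e1 : (0 : ℝ) ≤ (n : ℝ) ^ (-QQ α (k + 1)) := by positivity
  have e2 : (0 : ℝ) ≤ (n.choose k : ℝ) := by positivity
  nlinarith [mul_le_mul_of_nonneg_right h1 e1, mul_le_mul_of_nonneg_left h2 e2]

lemma part2 (c : ℕ) (α : ℕ → ℝ) (hα : ∀ i, 0 ≤ α i) (hS : GG c (fun j => aa α (j + 1)) < 1)
    (hS1 : 1 ≤ GG (c + 1) (fun j => aa α (j + 1))) :
    Tendsto (fun n : ℕ => multiMeasure n (fun i => (n : ℝ) ^ (-(α i)))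
            {ω | ¬ HomologyZero (multiComplex n ω) c ℚ}) atTop (nhds (1 : ENNReal)) := by
  set κ : ℝ := 1 / (2 ^ (c + 1) * ((c + 1).factorial : ℝ)) with hκ
  have hκ0 : 0 < κ := by positivity
  have l := fun m hm => cheb_lim α hα c hS hS1 m hm (2 ^ m / (κ / 16) ^ 2)
  have ll := ((l c (by omega)).add (l (c + 1) (by omega))).add (l (c + 2) (by omega))
  rw [add_zero, add_zero] at ll
  refine whp α _ _ ll ?_
  have hlt := NN_lt α hα c hS 1 c rfl le_rfl
  have t : Tendsto (fun n : ℕ => (n : ℝ) ^ (-(NN α (c + 1) - NN α c))) atTop (nhds 0) :=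
    (tendsto_rpow_neg_atTop (by linarith)).comp (tendsto_natCast_atTop_atTop (R := ℝ))
  have t' := t.eventually (gt_mem_nhds (show (0 : ℝ) < κ / 8 by positivity))
  filter_upwards [eventually_ge_atTop (2 * (c + 1)), t'] with n hn ht
  have hn1 : 1 ≤ n := by omega
  have hn0 : (0 : ℝ) < n := by exact_mod_cast hn1
  set A : ℝ := (n : ℝ) ^ (NN α (c + 1)) with hA
  have hA0 : 0 < A := Real.rpow_pos_of_pos hn0 _
  have ht2 : (n : ℝ) ^ (NN α c) < κ / 8 * A := by
    have : (n : ℝ) ^ (NN α c) = (n : ℝ) ^ (-(NN α (c + 1) - NN α c)) * A := by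
      rw [hA, ← Real.rpow_add hn0]; congr 1; ring
    rw [this]
    exact mul_lt_mul_of_pos_right ht hA0
  let B : ℕ → Set (MultiIdx n → Bool) := fun m => {ω | κ / 16 * A ≤ |Fc m ω - MM α n m|}
  have hB := fun m => cheb α hα hn1 m (κ / 16) (NN α (c + 1)) (by positivity)
  rw [ENNReal.ofReal_add (by positivity) (by positivity), ENNReal.ofReal_add (by positivity) (by positivity)]
  refine le_trans ?_ (add_le_add (add_le_add (hB c) (hB (c + 1))) (hB (c + 2)))
  refine le_trans (measure_mono ?_) ((measure_union_le _ _).trans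
    (add_le_add_left (measure_union_le _ _) _))
  intro ω hω
  by_contra hcon
  simp only [Set.mem_union, not_or, Set.mem_ofPred_eq, not_le] at hcon
  obtain ⟨⟨h1, h2⟩, h3⟩ := hcon
  have hz : HomologyZero (multiComplex n ω) c ℚ := by
    by_contra hz; exact hω hz
  have hm := morse _ c hz
  have hm' : Fc (c + 1) ω ≤ Fc c ω + Fc (c + 2) ω := by
    rw [Fc_eq, Fc_eq, Fc_eq]; exact_mod_cast hm
  have m1 := MM_lower α n (c + 1) hn hn1
  rw [← hκ, ← hA] at m1
  have m2 := MM_upper α n c hn1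
  have m3 := MM_half α n (c + 1) (by omega) hn1 hS1
  rw [← hA] at h1 h2 h3
  rw [abs_lt] at h1 h2 h3
  have : 0 < κ * A := by positivity
  have e : c + 1 + 1 = c + 2 := rfl
  rw [e] at m3
  linarith [h1.2, h2.1, h3.2]

end Part2b

noncomputable section
/-- **Fowler's homology-vanishing phase transition in the multiparameter model.**
Fix `k ≥ 1` and exponents `αᵢ ≥ 0`, and let `X = X(n; p₁, p₂, …)` with
`pᵢ = n^{−αᵢ}`. If `Σ_{i=1}^k αᵢ·C(k,i) < 1` then w.h.p. `H̃_{k−1}(X, ℚ) = 0`;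
if `Σ_{i=1}^k αᵢ·C(k,i) ≥ 1` and `Σ_{i=1}^{k−1} αᵢ·C(k−1,i) < 1` then w.h.p.
`H̃_{k−1}(X, ℚ) ≠ 0`. -/
theorem fowler_multiparameter (k : ℕ) (hk : 1 ≤ k) (α : ℕ → ℝ) (hα : ∀ i, 0 ≤ α i) :
    ((∑ i ∈ Finset.Icc 1 k, α i * (k.choose i : ℝ)) < 1 →
      Tendsto (fun n : ℕ =>
          multiMeasure n (fun i => (n : ℝ) ^ (-(α i)))
            {ω | HomologyZero (multiComplex n ω) (k - 1) ℚ})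
        atTop (nhds (1 : ENNReal))) ∧
    (1 ≤ (∑ i ∈ Finset.Icc 1 k, α i * (k.choose i : ℝ)) →
      (∑ i ∈ Finset.Icc 1 (k - 1), α i * ((k - 1).choose i : ℝ)) < 1 →
      Tendsto (fun n : ℕ =>
          multiMeasure n (fun i => (n : ℝ) ^ (-(α i)))
            {ω | ¬ HomologyZero (multiComplex n ω) (k - 1) ℚ})
        atTop (nhds (1 : ENNReal))) := by
  obtain ⟨c, rfl⟩ : ∃ c, k = c + 1 := ⟨k - 1, by omega⟩
  rw [Nat.add_sub_cancel]
  refine ⟨fun h => part1 c α hα ?_, fun h1 h2 => part2 c α hα ?_ ?_⟩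
  · rw [GG_S]; exact h
  · rw [GG_S]; exact h2
  · rw [GG_S]; exact h1
end
end

section
/- Fix k ≥ 1, and suppose p = p(n) satisfies p·n^{1/k} → ∞ and p·n^{1/(k+1)} → 0 as n → ∞. Then the expected k-th Betti number of the random clique complex X(n,p) satisfies E[β_k(X(n,p))] / ( C(n,k+1) · p^{C(k+1,2)} ) → 1 as n → ∞. -/
open MeasureTheory Filter Finset Matrix

noncomputable section

lemma betti_upper {V : Type} [Fintype V] [DecidableEq V] [LinearOrder V]
    (K : Finset (Finset V)) (k : ℕ) :
    bettiNumber K k ≤ Fintype.card {s : Finset V // s ∈ K ∧ s.card = k + 1} := by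
  unfold bettiNumber
  refine (Submodule.finrank_quotient_le _).trans ?_
  refine (Submodule.finrank_le _).trans ?_
  rw [Module.finrank_fintype_fun_eq_card]

lemma betti_lower {V : Type} [Fintype V] [DecidableEq V] [LinearOrder V]
    (K : Finset (Finset V)) (k : ℕ) :
    Fintype.card {s : Finset V // s ∈ K ∧ s.card = k + 1} ≤ bettiNumber K k
      + Fintype.card {s : Finset V // s ∈ K ∧ s.card = k + 2}
      + Fintype.card {s : Finset V // s ∈ K ∧ s.card = k} := by
  unfold bettiNumber
  have e1 := Submodule.finrank_quotient_add_finrank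
    ((LinearMap.range (chainBoundaryLin K (k + 1))).comap
        (LinearMap.ker (chainBoundaryLin K k)).subtype)
  have e2 := LinearMap.finrank_range_add_finrank_ker (chainBoundaryLin K k)
  have e3 := LinearMap.finrank_range_le (chainBoundaryLin K (k + 1))
  have e4 := Submodule.finrank_le (LinearMap.range (chainBoundaryLin K k))
  have e5 : Module.finrank ℝ ((LinearMap.range (chainBoundaryLin K (k + 1))).comap
        (LinearMap.ker (chainBoundaryLin K k)).subtype) ≤
      Module.finrank ℝ (LinearMap.range (chainBoundaryLin K (k + 1))) := by
    rw [← Submodule.finrank_map_subtype_eq]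
    exact Submodule.finrank_mono (Submodule.map_comap_le _ _)
  rw [Module.finrank_fintype_fun_eq_card] at e2 e3 e4
  change _ ≤ Fintype.card {s : Finset V // s ∈ K ∧ s.card = k + 2} at e3
  omega

lemma bern_true (p : ℝ) (h0 : 0 ≤ p) (h1 : p ≤ 1) :
    bernoulliBool p {true} = ENNReal.ofReal p := by
  simp [bernoulliBool, h0, h1]

lemma bern_univ (p : ℝ) (h0 : 0 ≤ p) (h1 : p ≤ 1) :
    bernoulliBool p Set.univ = 1 := by
  simp only [bernoulliBool, Measure.add_apply, Measure.smul_apply, smul_eq_mul,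
    measure_univ, mul_one, min_eq_left h1, max_eq_right h0]
  rw [← ENNReal.ofReal_add h0 (by linarith)]
  simp

lemma mem_clique_iff (n : ℕ) (s : Finset (Fin n)) (ω : FaceIdx n 1 → Bool) :
    s ∈ cliqueComplex n ω ↔ ∀ e : FaceIdx n 1, e.1 ⊆ s → ω e = true := by
  rw [cliqueComplex, Finset.mem_filter]
  simp only [Finset.mem_univ, true_and, graphOf]
  constructor
  · rintro h ⟨e, he⟩ hes
    obtain ⟨x, y, hxy, rfl⟩ := Finset.card_eq_two.mp he
    obtain ⟨-, ⟨e', he'⟩, hω, hx, hy⟩ := h x (hes (by simp)) y (hes (by simp)) hxy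
    have : ({x, y} : Finset (Fin n)) = e' := by
      apply Finset.eq_of_subset_of_card_le
      · intro z hz
        simp only [Finset.mem_insert, Finset.mem_singleton] at hz
        rcases hz with rfl | rfl <;> assumption
      · rw [he, he']
    subst this
    exact hω
  · intro h i hi j hj hij
    refine ⟨hij, ⟨{i, j}, Finset.card_pair hij⟩, h _ ?_, by simp, by simp⟩
    intro z hz
    simp only [Finset.mem_insert, Finset.mem_singleton] at hz
    rcases hz with rfl | rfl <;> assumption

lemma prob_clique (n : ℕ) (s : Finset (Fin n)) (p : ℝ) (h0 : 0 ≤ p) (h1 : p ≤ 1) :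
    (YMeasure n 1 p).real {ω | s ∈ cliqueComplex n ω} = p ^ (s.card.choose 2) := by
  classical
  have hset : {ω | s ∈ cliqueComplex n ω} =
      Set.pi Set.univ (fun e : FaceIdx n 1 => if e.1 ⊆ s then {true} else Set.univ) := by
    ext ω
    simp only [Set.mem_setOf_eq, mem_clique_iff, Set.mem_pi, Set.mem_univ, true_implies]
    refine forall_congr' fun e => ?_
    split_ifs with h <;> simp [h]
  have hm : ∀ e : FaceIdx n 1, bernoulliBool p (if e.1 ⊆ s then {true} else Set.univ) =
      if e.1 ⊆ s then ENNReal.ofReal p else 1 := by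
    intro e
    split_ifs
    · exact bern_true p h0 h1
    · exact bern_univ p h0 h1
  have hc : (Finset.univ.filter fun e : FaceIdx n 1 => e.1 ⊆ s).card = s.card.choose 2 := by
    rw [← Finset.card_powersetCard]
    refine Finset.card_bij (fun e _ => e.1) ?_ ?_ ?_
    · intro e he
      simp only [Finset.mem_filter, Finset.mem_univ, true_and] at he
      exact Finset.mem_powersetCard.mpr ⟨he, e.2⟩
    · intro a _ b _ h
      exact Subtype.ext h
    · intro b hb
      obtain ⟨h, h'⟩ := Finset.mem_powersetCard.mp hb
      exact ⟨⟨b, h'⟩, by simpa using h, rfl⟩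
  rw [measureReal_def, hset, YMeasure, Measure.pi_pi]
  simp_rw [hm]
  rw [Finset.prod_ite, Finset.prod_const_one, Finset.prod_const, hc, mul_one,
    ENNReal.toReal_pow, ENNReal.toReal_ofReal h0]

instance ymeas_finite (n : ℕ) (p : ℝ) : IsFiniteMeasure (YMeasure n 1 p) := by
  unfold YMeasure; infer_instance

lemma exp_faces (n c : ℕ) (p : ℝ) (h0 : 0 ≤ p) (h1 : p ≤ 1) :
    ∫ ω, (Fintype.card {s : Finset (Fin n) // s ∈ cliqueComplex n ω ∧ s.card = c} : ℝ)
      ∂ YMeasure n 1 p = (n.choose c : ℝ) * p ^ (c.choose 2) := by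
  classical
  have hf : ∀ ω : FaceIdx n 1 → Bool,
      (Fintype.card {s : Finset (Fin n) // s ∈ cliqueComplex n ω ∧ s.card = c} : ℝ) =
      ∑ s ∈ Finset.powersetCard c (Finset.univ : Finset (Fin n)),
        Set.indicator {ω | s ∈ cliqueComplex n ω} (fun _ => (1 : ℝ)) ω := by
    intro ω
    rw [Fintype.card_subtype]
    simp only [Set.indicator_apply, Set.mem_setOf_eq]
    rw [Finset.sum_boole]
    congr 2
    ext s
    simp [Finset.mem_powersetCard, and_comm]
  simp_rw [hf]
  rw [integral_finset_sum _ (fun s _ => Integrable.of_finite)]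
  have : ∀ s ∈ Finset.powersetCard c (Finset.univ : Finset (Fin n)),
      ∫ ω, Set.indicator {ω | s ∈ cliqueComplex n ω} (fun _ => (1 : ℝ)) ω ∂ YMeasure n 1 p
        = p ^ (c.choose 2) := by
    intro s hs
    rw [integral_indicator (Set.toFinite _).measurableSet]
    simp only [integral_const, smul_eq_mul, mul_one, measureReal_restrict_apply_univ]
    rw [prob_clique n s p h0 h1, (Finset.mem_powersetCard.mp hs).2]
  rw [Finset.sum_congr rfl this, Finset.sum_const, Finset.card_powersetCard]
  simp

lemma exp_bounds (n k : ℕ) (p : ℝ) (h0 : 0 ≤ p) (h1 : p ≤ 1) :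
    (∫ ω, (bettiNumber (cliqueComplex n ω) k : ℝ) ∂ YMeasure n 1 p) ≤
      (n.choose (k+1) : ℝ) * p ^ ((k+1).choose 2) ∧
    (n.choose (k+1) : ℝ) * p ^ ((k+1).choose 2) ≤
      (∫ ω, (bettiNumber (cliqueComplex n ω) k : ℝ) ∂ YMeasure n 1 p) +
      (n.choose (k+2) : ℝ) * p ^ ((k+2).choose 2) + (n.choose k : ℝ) * p ^ (k.choose 2) := by
  rw [← exp_faces n _ p h0 h1, ← exp_faces n _ p h0 h1, ← exp_faces n _ p h0 h1]
  constructor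
  · refine integral_mono Integrable.of_finite Integrable.of_finite fun ω => ?_
    exact (Nat.cast_le (α := ℝ)).mpr (betti_upper (cliqueComplex n ω) k)
  · rw [← integral_add Integrable.of_finite Integrable.of_finite,
      ← integral_add Integrable.of_finite Integrable.of_finite]
    refine integral_mono Integrable.of_finite Integrable.of_finite fun ω => ?_
    have h := (Nat.cast_le (α := ℝ)).mpr (betti_lower (cliqueComplex n ω) k)
    rw [Nat.cast_add, Nat.cast_add] at h
    exact h

lemma ratio_up (n k : ℕ) (a : ℝ) (h0 : 0 < a) :
    (n.choose (k+2) : ℝ) * a ^ ((k+2).choose 2) ≤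
      (n * a ^ (k+1)) * ((n.choose (k+1) : ℝ) * a ^ ((k+1).choose 2)) := by
  have e : (k+2).choose 2 = (k+1) + (k+1).choose 2 := by
    rw [Nat.choose_succ_succ' (k+1) 1]; simp
  have h : n.choose (k+2) ≤ n * n.choose (k+1) := by
    have := Nat.choose_succ_right_eq n (k+1)
    calc n.choose (k+2) ≤ n.choose (k+2) * (k+1+1) := Nat.le_mul_of_pos_right _ (by omega)
      _ = n.choose (k+1) * (n - (k+1)) := this
      _ ≤ n.choose (k+1) * n := Nat.mul_le_mul_left _ (by omega)
      _ = _ := mul_comm _ _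
  have h' : (n.choose (k+2) : ℝ) ≤ n * n.choose (k+1) := by exact_mod_cast h
  rw [e, pow_add]
  calc _ ≤ ((n : ℝ) * n.choose (k+1)) * (a ^ (k+1) * a ^ ((k+1).choose 2)) := by gcongr
    _ = _ := by ring

lemma ratio_down (n k : ℕ) (hn : 2 * k + 1 ≤ n) (a : ℝ) (h0 : 0 < a) :
    (n.choose k : ℝ) * a ^ (k.choose 2) ≤
      (2 * (k + 1) / (n * a ^ k)) * ((n.choose (k+1) : ℝ) * a ^ ((k+1).choose 2)) := by
  have e : (k+1).choose 2 = k + k.choose 2 := by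
    rw [Nat.choose_succ_succ' k 1]; simp
  have h : n.choose k * n ≤ 2 * (k + 1) * n.choose (k+1) := by
    have := Nat.choose_succ_right_eq n k
    calc n.choose k * n ≤ n.choose k * (2 * (n - k)) := Nat.mul_le_mul_left _ (by omega)
      _ = 2 * (n.choose k * (n - k)) := by ring
      _ = _ := by rw [← this]; ring
  have h' : (n.choose k : ℝ) * n ≤ 2 * (k + 1) * n.choose (k+1) := by exact_mod_cast h
  have hn0 : (0 : ℝ) < n := by exact_mod_cast (by omega : 0 < n)
  rw [e, pow_add, div_mul_eq_mul_div, le_div_iff₀ (by positivity)]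
  calc _ = ((n.choose k : ℝ) * n) * (a ^ k * a ^ (k.choose 2)) := by ring
    _ ≤ (2 * (k + 1) * n.choose (k+1)) * (a ^ k * a ^ (k.choose 2)) := by gcongr
    _ = _ := by ring

end

noncomputable section
/-- **The expected Betti numbers of the random clique complex** (Kahle). Fix
`k ≥ 1` and suppose `p·n^{1/k} → ∞` and `p·n^{1/(k+1)} → 0`. Then
`E[β_k(X(n,p))] / (C(n,k+1)·p^{C(k+1,2)}) → 1`. -/
theorem clique_complex_expected_betti (k : ℕ) (hk : 1 ≤ k) (p : ℕ → ℝ)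
    (h1 : Tendsto (fun n : ℕ => p n * (n : ℝ) ^ ((1 : ℝ) / (k : ℝ))) atTop atTop)
    (h2 : Tendsto (fun n : ℕ => p n * (n : ℝ) ^ ((1 : ℝ) / ((k : ℝ) + 1))) atTop (nhds 0)) :
    Tendsto (fun n : ℕ =>
        (∫ ω, (bettiNumber (cliqueComplex n ω) k : ℝ) ∂ YMeasure n 1 (p n)) /
          ((n.choose (k + 1) : ℝ) * p n ^ ((k + 1).choose 2)))
      atTop (nhds 1) := by
  have hrp : ∀ (m : ℕ), 1 ≤ m → ∀ n : ℕ,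
      (p n * (n : ℝ) ^ ((1 : ℝ) / (m : ℝ))) ^ m = n * p n ^ m := by
    intro m hm n
    rw [mul_pow, ← Real.rpow_natCast ((n : ℝ) ^ ((1 : ℝ) / (m : ℝ))) m,
      ← Real.rpow_mul (Nat.cast_nonneg n), one_div,
      inv_mul_cancel₀ (by positivity), Real.rpow_one, mul_comm]
  have hx : Tendsto (fun n : ℕ => (n : ℝ) * p n ^ (k + 1)) atTop (nhds 0) := by
    have := h2.pow (k + 1)
    rw [zero_pow (by omega)] at this
    refine this.congr fun n => ?_
    rw [← hrp (k + 1) (by omega) n]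
    push_cast
    rfl
  have hz : Tendsto (fun n : ℕ => (n : ℝ) * p n ^ k) atTop atTop := by
    have := (tendsto_pow_atTop (α := ℝ) (n := k) (by omega)).comp h1
    refine this.congr fun n => ?_
    exact hrp k hk n
  have hy : Tendsto (fun n : ℕ => 2 * ((k : ℝ) + 1) / ((n : ℝ) * p n ^ k)) atTop (nhds 0) :=
    hz.const_div_atTop _
  have hpos : ∀ᶠ n in atTop, 0 < p n := by
    filter_upwards [h1.eventually_gt_atTop 0] with n hn
    exact pos_of_mul_pos_left hn (Real.rpow_nonneg (Nat.cast_nonneg n) _)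
  have hle : ∀ᶠ n in atTop, p n ≤ 1 := by
    filter_upwards [h2.eventually (gt_mem_nhds one_pos), hpos, eventually_ge_atTop 1]
      with n hn h0 hn1
    have : (1 : ℝ) ≤ (n : ℝ) ^ ((1 : ℝ) / ((k : ℝ) + 1)) :=
      Real.one_le_rpow (by exact_mod_cast hn1) (by positivity)
    nlinarith
  have hlow : Tendsto (fun n : ℕ => 1 - (n : ℝ) * p n ^ (k + 1)
      - 2 * ((k : ℝ) + 1) / ((n : ℝ) * p n ^ k)) atTop (nhds 1) := by
    simpa using (tendsto_const_nhds (x := (1 : ℝ))).sub hx |>.sub hy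
  refine tendsto_of_tendsto_of_tendsto_of_le_of_le' hlow tendsto_const_nhds ?_ ?_
  · filter_upwards [hpos, hle, eventually_ge_atTop (2 * k + 1)] with n h0 h1 hn
    have hF : 0 < (n.choose (k + 1) : ℝ) * p n ^ ((k + 1).choose 2) := by
      have : 0 < n.choose (k + 1) := Nat.choose_pos (by omega)
      positivity
    rw [le_div_iff₀ hF]
    have b := (exp_bounds n k (p n) h0.le h1).2
    have u := ratio_up n k (p n) h0
    have d := ratio_down n k hn (p n) h0
    rw [sub_mul, sub_mul, one_mul]
    linarith
  · filter_upwards [hpos, hle] with n h0 h1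
    exact div_le_one_of_le₀ (exp_bounds n k (p n) h0.le h1).1 (by positivity)
end
end
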